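/- arXiv:1703.08145 — 2 statements merged into one kernel-verified Lean document; each statement's English description precedes it below -/
import Mathlib

section
/- Write m = 5^α m', n = 5^β n' with 5 ∤ m'n'. If α > β, then a₀^{(25)}(m,n) ≡ 0 (mod 5^{2(α−β)+1}); if β > α, then a₀^{(25)}(m,n) ≡ 0 (mod 5^{(β−α)+1}). -/
open scoped Manifold
open Complex UpperHalfPlane ModularForm Matrix MatrixGroups

noncomputable def qq (z : ℂ) : ℂ := Complex.exp (2 * Real.pi * Complex.I * z)

noncomputable def dedekindEta (z : ℂ) : ℂ :=
  Complex.exp (Real.pi * Complex.I * z / 12) * ∏' n : ℕ, (1 - qq ((n + 1) * z))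

/-- `f` is a weakly holomorphic modular form of weight `k` on `Γ₀(N)`
whose only possible pole among the cusps is at `∞`. -/
def IsWeaklyHolomorphicSharp (k : ℤ) (N : ℕ) (f : ℍ → ℂ) : Prop :=
  MDifferentiable 𝓘(ℂ) 𝓘(ℂ) f ∧
  (∀ γ ∈ CongruenceSubgroup.Gamma0 N, f ∣[k] γ = f) ∧
  (∀ γ : SL(2, ℤ), ∃ M : ℕ,
    UpperHalfPlane.IsBoundedAtImInfty (fun z => qq z ^ M * (f ∣[k] γ) z)) ∧
  (∀ γ : SL(2, ℤ), ¬ ((N : ℤ) ∣ (γ : Matrix (Fin 2) (Fin 2) ℤ) 1 0) →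
    UpperHalfPlane.IsBoundedAtImInfty (f ∣[k] γ))

/-- `f` additionally vanishes at every cusp other than `∞`. -/
def IsWeaklyHolomorphicSharpCusp (k : ℤ) (N : ℕ) (f : ℍ → ℂ) : Prop :=
  IsWeaklyHolomorphicSharp k N f ∧
  (∀ γ : SL(2, ℤ), ¬ ((N : ℤ) ∣ (γ : Matrix (Fin 2) (Fin 2) ℤ) 1 0) →
    UpperHalfPlane.IsZeroAtImInfty (f ∣[k] γ))

/-- `f` is the canonical basis element `f_{0,m}^{(N)}` with coefficients `a`. -/
def IsCanonicalBasis0 (N : ℕ) (m : ℕ) (f : ℍ → ℂ) (a : ℕ → ℤ) : Prop :=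
  IsWeaklyHolomorphicSharp 0 N f ∧
  ∀ z : ℍ, f z = qq z ^ (-(m : ℤ)) + ∑' n : ℕ, (a (n + 1) : ℂ) * qq z ^ ((n : ℕ) + 1)

noncomputable def Uop (p : ℕ) (f : ℍ → ℂ) : ℍ → ℂ := fun z =>
  (p : ℂ)⁻¹ * ∑ j ∈ Finset.range p, f (((j : ℝ) / p) +ᵥ z)

noncomputable def Vop (p : ℕ) (f : ℍ → ℂ) : ℍ → ℂ := fun z =>
  if h : 0 < p then
    f ⟨p * z, by simpa using mul_pos (by exact_mod_cast h : (0:ℝ) < p) z.2⟩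
  else 0

namespace FormalLaurent

theorem exists_coeff_eq_zero_of_lt (x : LaurentSeries ℤ) : ∃ k : ℤ, ∀ n < k, x.coeff n = 0 :=
  ⟨x.order, fun _ hn => HahnSeries.coeff_eq_zero_of_lt_order hn⟩

theorem coeff_intCast_mul (a : ℤ) (x : LaurentSeries ℤ) (n : ℤ) :
    ((a : LaurentSeries ℤ) * x).coeff n = a * x.coeff n := by
  rw [← map_intCast (HahnSeries.C : ℤ →+* LaurentSeries ℤ), HahnSeries.C_apply,
    HahnSeries.coeff_single_zero_mul]
  rfl

theorem coeff_mul_eq_sum {x y : LaurentSeries ℤ} {k l : ℤ} (hx : ∀ n < k, x.coeff n = 0)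
    (hy : ∀ n < l, y.coeff n = 0) (n : ℤ) :
    (x * y).coeff n = ∑ i ∈ Finset.Icc k (n - l), x.coeff i * y.coeff (n - i) := by
  rw [HahnSeries.coeff_mul]
  refine Finset.sum_bij_ne_zero (fun p _ _ => p.1) ?_ ?_ ?_ ?_
  · rintro ⟨i, j⟩ hp h0
    have hi := left_ne_zero_of_mul h0
    have hj := right_ne_zero_of_mul h0
    rw [Finset.mem_antidiagonal] at hp
    have h1 : ¬ i < k := fun h => hi (hx _ h)
    have h2 : ¬ j < l := fun h => hj (hy _ h)
    have := hp.2.2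
    simp only at this
    rw [Finset.mem_Icc]
    exact ⟨by simp only; omega, by simp only; omega⟩
  · rintro ⟨i, j⟩ hp _ ⟨i', j'⟩ hp' _ h
    rw [Finset.mem_antidiagonal] at hp hp'
    have h1 := hp.2.2
    have h2 := hp'.2.2
    simp only at h h1 h2
    ext <;> simp only <;> omega
  · intro i _ h0
    refine ⟨(i, n - i), ?_, h0, rfl⟩
    rw [Finset.mem_antidiagonal]
    exact ⟨left_ne_zero_of_mul h0, right_ne_zero_of_mul h0, by simp⟩
  · rintro ⟨i, j⟩ hp _
    rw [Finset.mem_antidiagonal] at hp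
    have h1 := hp.2.2
    simp only at h1 ⊢
    rw [← h1]; simp

theorem coeff_mul_eq_zero_of_lt {x y : LaurentSeries ℤ} {k l : ℤ} (hx : ∀ n < k, x.coeff n = 0)
    (hy : ∀ n < l, y.coeff n = 0) {n : ℤ} (hn : n < k + l) : (x * y).coeff n = 0 := by
  rw [coeff_mul_eq_sum hx hy, Finset.Icc_eq_empty (by omega), Finset.sum_empty]

theorem coeff_mul_add {x y : LaurentSeries ℤ} {k l : ℤ} (hx : ∀ n < k, x.coeff n = 0)
    (hy : ∀ n < l, y.coeff n = 0) :
    (x * y).coeff (k + l) = x.coeff k * y.coeff l := by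
  rw [coeff_mul_eq_sum hx hy]; simp

theorem coeff_pow_eq_zero_of_lt {x : LaurentSeries ℤ} {k : ℤ} (hx : ∀ n < k, x.coeff n = 0)
    (m : ℕ) : ∀ n < m * k, (x ^ m).coeff n = 0 := by
  induction m with
  | zero => intro n hn; simp at hn; simp [HahnSeries.coeff_one, hn.ne]
  | succ m ih =>
    intro n hn
    rw [pow_succ]
    exact coeff_mul_eq_zero_of_lt ih hx (by push_cast at hn; linarith)

theorem coeff_pow_mul {x : LaurentSeries ℤ} {k : ℤ} (hx : ∀ n < k, x.coeff n = 0) (m : ℕ) :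
    (x ^ m).coeff (m * k) = x.coeff k ^ m := by
  induction m with
  | zero => simp
  | succ m ih =>
    rw [pow_succ, pow_succ, ← ih, ← coeff_mul_add (coeff_pow_eq_zero_of_lt hx m) hx]
    congr 1; push_cast; ring

/-- The operator keeping every fifth coefficient. -/
noncomputable def U5 : LaurentSeries ℤ →+ LaurentSeries ℤ where
  toFun x := HahnSeries.ofSuppBddBelow (fun n => x.coeff (5 * n)) (by
    obtain ⟨k, hk⟩ := exists_coeff_eq_zero_of_lt x
    refine ⟨min k 0, fun n hn => ?_⟩
    by_contra h
    exact hn (hk _ (by omega)))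
  map_zero' := by ext n; simp
  map_add' x y := by ext n; simp

@[simp] theorem coeff_U5 (x : LaurentSeries ℤ) (n : ℤ) : (U5 x).coeff n = x.coeff (5 * n) := by
  simp [U5]

theorem coeff_U5_iterate (b : ℕ) (x : LaurentSeries ℤ) (n : ℤ) :
    (U5^[b] x).coeff n = x.coeff (5 ^ b * n) := by
  induction b generalizing x with
  | zero => simp
  | succ b ih => rw [Function.iterate_succ_apply, ih, coeff_U5]; congr 1; ring

theorem injective_five_mul : Function.Injective (AddMonoidHom.mulLeft (5 : ℤ)) :=
  fun a b h => by simpa using h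

/-- Substitution of the fifth power of the variable. -/
noncomputable def V5 : LaurentSeries ℤ →+* LaurentSeries ℤ :=
  HahnSeries.embDomainRingHom (AddMonoidHom.mulLeft (5 : ℤ)) injective_five_mul
    (fun a b => by simp)

@[simp] theorem coeff_V5_mul (x : LaurentSeries ℤ) (n : ℤ) : (V5 x).coeff (5 * n) = x.coeff n :=
  HahnSeries.embDomain_coeff (f := ⟨⟨_, injective_five_mul⟩, fun {a b} => by simp⟩)

theorem coeff_V5_of_not_dvd (x : LaurentSeries ℤ) {n : ℤ} (h : ¬ 5 ∣ n) : (V5 x).coeff n = 0 :=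
  HahnSeries.embDomain_of_notMem_range (by rintro ⟨k, rfl⟩; exact h ⟨k, rfl⟩)

theorem V5_ofPowerSeries (f : PowerSeries ℤ) :
    V5 (HahnSeries.ofPowerSeries ℤ ℤ f)
      = HahnSeries.ofPowerSeries ℤ ℤ (PowerSeries.expand 5 (by norm_num) f) := by
  ext n
  rw [PowerSeries.coeff_coe]
  by_cases h : 5 ∣ n
  · obtain ⟨k, rfl⟩ := h
    rw [coeff_V5_mul, PowerSeries.coeff_coe]
    rcases lt_or_ge k 0 with hk | hk
    · rw [if_pos hk, if_pos (by omega)]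
    · rw [if_neg (by omega), if_neg (by omega), Int.natAbs_mul]
      exact (PowerSeries.coeff_expand_mul 5 _ f _).symm
  · rw [coeff_V5_of_not_dvd _ h]
    split_ifs with hn
    · rfl
    · rw [PowerSeries.coeff_expand_of_not_dvd]
      omega

theorem V5_coeff_eq_zero_of_lt {x : LaurentSeries ℤ} {k : ℤ} (hx : ∀ n < k, x.coeff n = 0) :
    ∀ n < 5 * k, (V5 x).coeff n = 0 := by
  intro n hn
  by_cases h : 5 ∣ n
  · obtain ⟨j, rfl⟩ := h
    rw [coeff_V5_mul, hx _ (by omega)]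
  · exact coeff_V5_of_not_dvd _ h

theorem U5_V5_mul (x y : LaurentSeries ℤ) : U5 (V5 x * y) = x * U5 y := by
  obtain ⟨k, hk⟩ := exists_coeff_eq_zero_of_lt x
  obtain ⟨l', hl'⟩ := exists_coeff_eq_zero_of_lt y
  obtain ⟨l, hl, hl2⟩ : ∃ l : ℤ, (∀ n < 5 * l, y.coeff n = 0) ∧ True :=
    ⟨l' / 5, fun n hn => hl' n (by omega), trivial⟩
  have hU : ∀ n < l, (U5 y).coeff n = 0 := fun n hn => by rw [coeff_U5, hl _ (by omega)]
  ext n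
  rw [coeff_U5, coeff_mul_eq_sum (V5_coeff_eq_zero_of_lt hk) hl, coeff_mul_eq_sum hk hU]
  symm
  refine Finset.sum_bij_ne_zero (fun i _ _ => 5 * i) ?_ ?_ ?_ ?_
  · intro i hi _
    rw [Finset.mem_Icc] at hi ⊢
    omega
  · intro i _ _ j _ _ h
    simpa using h
  · intro i hi h0
    have h5 : 5 ∣ i := by
      by_contra h
      exact h0 (by rw [coeff_V5_of_not_dvd _ h, zero_mul])
    obtain ⟨j, rfl⟩ := h5
    refine ⟨j, ?_, ?_, rfl⟩
    · rw [Finset.mem_Icc] at hi ⊢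
      omega
    · rwa [coeff_V5_mul, ← mul_sub, ← coeff_U5] at h0
  · intro i _ _
    rw [coeff_V5_mul, coeff_U5, mul_sub]

/-- The derivation `q d/dq`. -/
noncomputable def theta : LaurentSeries ℤ →+ LaurentSeries ℤ where
  toFun x := HahnSeries.ofSuppBddBelow (fun n => n * x.coeff n) (by
    obtain ⟨k, hk⟩ := exists_coeff_eq_zero_of_lt x
    refine ⟨k, fun n hn => ?_⟩
    by_contra h
    exact hn (show n * x.coeff n = 0 by rw [hk n (by omega), mul_zero]))
  map_zero' := by ext n; simp
  map_add' x y := by ext n; simp [mul_add]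

@[simp] theorem coeff_theta (x : LaurentSeries ℤ) (n : ℤ) :
    (theta x).coeff n = n * x.coeff n := by
  simp [theta]

theorem theta_mul (x y : LaurentSeries ℤ) : theta (x * y) = theta x * y + x * theta y := by
  obtain ⟨k, hk⟩ := exists_coeff_eq_zero_of_lt x
  obtain ⟨l, hl⟩ := exists_coeff_eq_zero_of_lt y
  have hk' : ∀ n < k, (theta x).coeff n = 0 := fun n hn => by simp [hk n hn]
  have hl' : ∀ n < l, (theta y).coeff n = 0 := fun n hn => by simp [hl n hn]
  ext n
  rw [HahnSeries.coeff_add, coeff_theta, coeff_mul_eq_sum hk hl, coeff_mul_eq_sum hk' hl,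
    coeff_mul_eq_sum hk hl', ← Finset.sum_add_distrib, Finset.mul_sum]
  refine Finset.sum_congr rfl fun i _ => ?_
  simp only [coeff_theta]
  ring

theorem theta_one : theta 1 = 0 := by
  ext n
  by_cases h : n = 0 <;> simp [HahnSeries.coeff_one, h]

theorem theta_pow_succ (x : LaurentSeries ℤ) (k : ℕ) :
    theta (x ^ (k + 1)) = ((k + 1 : ℤ) : LaurentSeries ℤ) * (x ^ k * theta x) := by
  induction k with
  | zero => simp
  | succ k ih => rw [pow_succ, theta_mul, ih]; push_cast; ring

theorem theta_intCast (a : ℤ) : theta (a : LaurentSeries ℤ) = 0 := by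
  rw [← mul_one (a : LaurentSeries ℤ)]
  ext n
  rw [coeff_theta, coeff_intCast_mul, HahnSeries.coeff_one, HahnSeries.coeff_zero]
  split_ifs with h <;> simp [h]

theorem theta_V5 (x : LaurentSeries ℤ) :
    theta (V5 x) = ((5 : ℤ) : LaurentSeries ℤ) * V5 (theta x) := by
  ext n
  rw [coeff_intCast_mul, coeff_theta]
  by_cases h : 5 ∣ n
  · obtain ⟨k, rfl⟩ := h
    rw [coeff_V5_mul, coeff_V5_mul, coeff_theta]
    ring
  · rw [coeff_V5_of_not_dvd _ h, coeff_V5_of_not_dvd _ h, mul_zero, mul_zero]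

theorem coeff_zero_pow_mul_theta (x : LaurentSeries ℤ) (k : ℕ) :
    (x ^ k * theta x).coeff 0 = 0 := by
  have h := coeff_theta (x ^ (k + 1)) 0
  rw [theta_pow_succ, coeff_intCast_mul, zero_mul] at h
  exact (mul_eq_zero.mp h).resolve_left (by positivity)

/-- The evaluation of integer polynomials at a Laurent series. -/
noncomputable def evalInt (x : LaurentSeries ℤ) : Polynomial ℤ →+* LaurentSeries ℤ :=
  Polynomial.eval₂RingHom (Int.castRingHom _) x

@[simp] theorem evalInt_X (x : LaurentSeries ℤ) : evalInt x Polynomial.X = x := by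
  simp [evalInt]

theorem evalInt_monomial (x : LaurentSeries ℤ) (n : ℕ) (a : ℤ) :
    evalInt x (Polynomial.monomial n a) = a * x ^ n := by
  simp [evalInt, Polynomial.eval₂_monomial]

theorem coeff_zero_evalInt_mul_theta (x : LaurentSeries ℤ) (p : Polynomial ℤ) :
    (evalInt x p * theta x).coeff 0 = 0 := by
  induction p using Polynomial.induction_on' with
  | add p q hp hq => rw [map_add, add_mul, HahnSeries.coeff_add, hp, hq, add_zero]
  | monomial n a =>
    rw [evalInt_monomial, mul_assoc, coeff_intCast_mul, coeff_zero_pow_mul_theta, mul_zero]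

theorem exists_theta_evalInt (x : LaurentSeries ℤ) (p : Polynomial ℤ) :
    ∃ r : Polynomial ℤ, theta (evalInt x p) = evalInt x r * theta x := by
  induction p using Polynomial.induction_on' with
  | add p q hp hq =>
    obtain ⟨r, hr⟩ := hp
    obtain ⟨r', hr'⟩ := hq
    exact ⟨r + r', by rw [map_add, map_add, map_add, hr, hr', add_mul]⟩
  | monomial n a =>
    rw [evalInt_monomial, theta_mul, theta_intCast, zero_mul, zero_add]
    cases n with
    | zero => exact ⟨0, by simp [theta_one]⟩
    | succ k =>
      refine ⟨Polynomial.monomial k (a * (k + 1)), ?_⟩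
      rw [theta_pow_succ, evalInt_monomial]
      push_cast
      ring

theorem coeff_zero_evalInt_mul_theta_evalInt (x : LaurentSeries ℤ) (p r : Polynomial ℤ) :
    (evalInt x p * theta (evalInt x r)).coeff 0 = 0 := by
  obtain ⟨r', hr'⟩ := exists_theta_evalInt x r
  rw [hr', ← mul_assoc, ← map_mul, coeff_zero_evalInt_mul_theta]

end FormalLaurent

namespace FormalLaurent

/-- Expansion data for Hauptmoduln `s` of level 25 and `t` of level 5. -/
structure HauptmodulPair (s t : (LaurentSeries ℤ)ˣ) : Prop where
  s_lt : ∀ n < -1, (s : LaurentSeries ℤ).coeff n = 0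
  s_neg_one : (s : LaurentSeries ℤ).coeff (-1) = 1
  s_zero : (s : LaurentSeries ℤ).coeff 0 = -1
  s_one : (s : LaurentSeries ℤ).coeff 1 = -1
  s_two : (s : LaurentSeries ℤ).coeff 2 = 0
  s_three : (s : LaurentSeries ℤ).coeff 3 = 0
  t_lt : ∀ n < -1, (t : LaurentSeries ℤ).coeff n = 0
  t_neg_one : (t : LaurentSeries ℤ).coeff (-1) = 1
  t_inv_lt : ∀ n < 1, ((t⁻¹ : (LaurentSeries ℤ)ˣ) : LaurentSeries ℤ).coeff n = 0
  V5_t : V5 t = (s : LaurentSeries ℤ) ^ 5 + 5 * (s : LaurentSeries ℤ) ^ 4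
    + 15 * (s : LaurentSeries ℤ) ^ 3 + 25 * (s : LaurentSeries ℤ) ^ 2 + 25 * s
  t_mul_V5_t : (t : LaurentSeries ℤ) * V5 t = (s : LaurentSeries ℤ) ^ 6

namespace HauptmodulPair

variable {s t : (LaurentSeries ℤ)ˣ}

theorem evalInt_eq_zero {x : LaurentSeries ℤ} (hx : ∀ n < -1, x.coeff n = 0)
    (hx1 : x.coeff (-1) = 1) (p : Polynomial ℤ) (h : ∀ n ≤ 0, (evalInt x p).coeff n = 0) :
    p = 0 := by
  by_contra hp
  have key : ∀ d : ℕ, (evalInt x (∑ i ∈ Finset.range (d + 1),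
      Polynomial.monomial i (p.coeff i))).coeff (d * (-1)) = p.coeff d := by
    intro d
    rw [map_sum, Finset.sum_range_succ, HahnSeries.coeff_add, HahnSeries.coeff_sum,
      Finset.sum_eq_zero, zero_add, evalInt_monomial, coeff_intCast_mul,
      coeff_pow_mul hx, hx1, one_pow, mul_one]
    intro i hi
    rw [Finset.mem_range] at hi
    rw [evalInt_monomial, coeff_intCast_mul, coeff_pow_eq_zero_of_lt hx _ _ (by omega), mul_zero]
  specialize key p.natDegree
  rw [← p.as_sum_range] at key
  rw [h _ (by omega)] at key
  exact hp (Polynomial.leadingCoeff_eq_zero.mp key.symm)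

theorem eq_zero_of_coeff_zero_mul_pow_mul_theta {x B : LaurentSeries ℤ}
    (hx : ∀ n < -1, x.coeff n = 0) (hx1 : x.coeff (-1) = 1) (hB : ∀ n < 1, B.coeff n = 0)
    (h : ∀ n : ℕ, (B * (x ^ n * theta x)).coeff 0 = 0) : B = 0 := by
  have hth : ∀ n < -1, (theta x).coeff n = 0 := fun n hn => by simp [hx n hn]
  have key : ∀ n : ℕ, ∀ k < (n + 1 : ℤ), B.coeff k = 0 := by
    intro n
    induction n with
    | zero => simpa using hB
    | succ n ih =>
      intro k hk
      rcases lt_or_eq_of_le (show k ≤ (n + 1 : ℤ) by push_cast at hk; omega) with hk | rfl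
      · exact ih k hk
      have h1 : ∀ k < -(n + 1 : ℤ), (x ^ n * theta x).coeff k = 0 := fun k hk =>
        coeff_mul_eq_zero_of_lt (coeff_pow_eq_zero_of_lt hx n) hth (by omega)
      have h2 := h n
      have h3 : (x ^ n * theta x).coeff (-(n + 1 : ℤ)) = -1 := by
        have := coeff_mul_add (coeff_pow_eq_zero_of_lt hx n) hth
        rw [coeff_pow_mul hx, coeff_theta, hx1] at this
        rw [← show (n : ℤ) * -1 + -1 = -(n + 1 : ℤ) by ring, this]
        simp
      rw [← add_neg_cancel (n + 1 : ℤ), coeff_mul_add ih h1, h3] at h2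
      linarith
  ext k
  exact key k.toNat k (by omega)

variable (D : HauptmodulPair s t)
include D

theorem s_pow_coeffs : ((s : LaurentSeries ℤ) ^ 2).coeff 0 = -1 ∧
    ((s : LaurentSeries ℤ) ^ 3).coeff 0 = 5 ∧ ((s : LaurentSeries ℤ) ^ 4).coeff 0 = -5 := by
  have e2 : ∀ n, ((s : LaurentSeries ℤ) ^ 2).coeff n =
      ∑ i ∈ Finset.Icc (-1) (n - -1), (s : LaurentSeries ℤ).coeff i
        * (s : LaurentSeries ℤ).coeff (n - i) := fun n => by
    rw [pow_two]; exact coeff_mul_eq_sum D.s_lt D.s_lt n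
  have h2 := coeff_pow_eq_zero_of_lt D.s_lt 2
  have I1 : Finset.Icc (-1 : ℤ) (-2 - -1) = {-1} := by decide
  have I2 : Finset.Icc (-1 : ℤ) (-1 - -1) = {-1, 0} := by decide
  have I3 : Finset.Icc (-1 : ℤ) (0 - -1) = {-1, 0, 1} := by decide
  have I4 : Finset.Icc (-1 : ℤ) (1 - -1) = {-1, 0, 1, 2} := by decide
  have I5 : Finset.Icc (-1 : ℤ) (2 - -1) = {-1, 0, 1, 2, 3} := by decide
  have I6 : Finset.Icc (-1 : ℤ) (0 - (2 : ℕ) * -1) = {-1, 0, 1, 2} := by decide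
  have I7 : Finset.Icc ((2 : ℕ) * -1 : ℤ) (0 - (2 : ℕ) * -1) = {-2, -1, 0, 1, 2} := by decide
  have a0 := e2 (-2)
  have a1 := e2 (-1)
  have a2 := e2 0
  have a3 := e2 1
  have a4 := e2 2
  rw [I1] at a0
  rw [I2] at a1
  rw [I3] at a2
  rw [I4] at a3
  rw [I5] at a4
  have a5 := coeff_mul_eq_sum D.s_lt h2 0
  rw [← pow_succ', I6] at a5
  have a6 := coeff_mul_eq_sum h2 h2 0
  rw [← pow_add, I7] at a6
  norm_num [D.s_neg_one, D.s_zero, D.s_one, D.s_two, D.s_three] at a0 a1 a2 a3 a4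
  norm_num [D.s_neg_one, D.s_zero, D.s_one, D.s_two, D.s_three, a0, a1, a2, a3, a4] at a5 a6
  exact ⟨a2, a5, a6⟩

/-- Values of `U5` on powers of `s`. -/
theorem U5_pow_rec (n : ℤ) : (t : LaurentSeries ℤ) *
    U5 ((s ^ n : (LaurentSeries ℤ)ˣ) : LaurentSeries ℤ) =
    U5 ((s ^ (n + 5) : (LaurentSeries ℤ)ˣ) : LaurentSeries ℤ)
    + 5 * U5 ((s ^ (n + 4) : (LaurentSeries ℤ)ˣ) : LaurentSeries ℤ)
    + 15 * U5 ((s ^ (n + 3) : (LaurentSeries ℤ)ˣ) : LaurentSeries ℤ)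
    + 25 * U5 ((s ^ (n + 2) : (LaurentSeries ℤ)ˣ) : LaurentSeries ℤ)
    + 25 * U5 ((s ^ (n + 1) : (LaurentSeries ℤ)ˣ) : LaurentSeries ℤ) := by
  have h : ∀ (c : ℕ) (x : LaurentSeries ℤ), U5 ((c : LaurentSeries ℤ) * x) = c * U5 x :=
    fun c x => by rw [← nsmul_eq_mul, map_nsmul, nsmul_eq_mul]
  rw [← U5_V5_mul, D.V5_t]
  have h5 := h 5
  have h15 := h 15
  have h25 := h 25
  push_cast at h5 h15 h25
  rw [← h5, ← h15, ← h25, ← h25, ← map_add, ← map_add, ← map_add, ← map_add]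
  congr 1
  simp only [_root_.zpow_add, Units.val_mul, zpow_ofNat, Units.val_pow_eq_pow_val]
  ring

theorem coeff_s_pow_mul_pow_theta (k n : ℕ) :
    (U5 ((s : LaurentSeries ℤ) ^ k) * ((t : LaurentSeries ℤ) ^ n * theta t)).coeff 0 = 0 := by
  have hp : V5 t = evalInt s (Polynomial.X ^ 5 + 5 * Polynomial.X ^ 4 + 15 * Polynomial.X ^ 3
      + 25 * Polynomial.X ^ 2 + 25 * Polynomial.X) := by
    have h := fun (c : ℕ) => map_natCast (evalInt (s : LaurentSeries ℤ)) c
    have h5 := h 5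
    have h15 := h 15
    have h25 := h 25
    push_cast at h5 h15 h25
    simp only [D.V5_t, map_add, map_mul, map_pow, evalInt_X, h5, h15, h25]
  have h := coeff_zero_evalInt_mul_theta_evalInt (s : LaurentSeries ℤ)
    (Polynomial.X ^ k * (Polynomial.X ^ 5 + 5 * Polynomial.X ^ 4 + 15 * Polynomial.X ^ 3
      + 25 * Polynomial.X ^ 2 + 25 * Polynomial.X) ^ n)
    (Polynomial.X ^ 5 + 5 * Polynomial.X ^ 4 + 15 * Polynomial.X ^ 3
      + 25 * Polynomial.X ^ 2 + 25 * Polynomial.X)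
  rw [map_mul, map_pow, map_pow, ← hp, theta_V5, evalInt_X, mul_left_comm, coeff_intCast_mul,
    mul_assoc, ← map_pow, ← map_mul, mul_comm] at h
  rw [mul_comm, ← U5_V5_mul, coeff_U5, mul_zero]
  simpa [mul_comm] using h

theorem U5_pow_eq {k : ℕ} (hk : 0 < k) (hk5 : k < 5) :
    U5 ((s : LaurentSeries ℤ) ^ k) =
        ((((s : LaurentSeries ℤ) ^ k).coeff 0 : ℤ) : LaurentSeries ℤ) := by
  rw [← sub_eq_zero]
  refine eq_zero_of_coeff_zero_mul_pow_mul_theta D.t_lt D.t_neg_one (fun n hn => ?_) fun n => ?_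
  · rw [HahnSeries.coeff_sub, coeff_U5, ← mul_one (Int.cast _), coeff_intCast_mul]
    rcases lt_or_eq_of_le (show n ≤ 0 by omega) with h | rfl
    · rw [coeff_pow_eq_zero_of_lt D.s_lt _ _ (by omega), HahnSeries.coeff_one, if_neg h.ne]
      simp
    · simp [HahnSeries.coeff_one]
  · rw [sub_mul, HahnSeries.coeff_sub, D.coeff_s_pow_mul_pow_theta, coeff_intCast_mul,
      coeff_zero_pow_mul_theta, mul_zero, sub_zero]

omit D in
theorem U5_one : U5 (1 : LaurentSeries ℤ) = 1 := by
  ext n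
  simp [HahnSeries.coeff_one]

end HauptmodulPair
end FormalLaurent

namespace FormalLaurent

/-- The additive span of the elements `5 ^ w j * φ ^ j` with `J j`. -/
def powSpan (φ : (LaurentSeries ℤ)ˣ) (w : ℤ → ℕ) (J : ℤ → Prop) : AddSubgroup (LaurentSeries ℤ) :=
  AddSubgroup.closure {x | ∃ j, J j ∧ x = 5 ^ w j *
      ((φ ^ j : (LaurentSeries ℤ)ˣ) : LaurentSeries ℤ)}

variable {φ : (LaurentSeries ℤ)ˣ} {w w' : ℤ → ℕ} {J J' : ℤ → Prop}

theorem map_mem_of_mem_powSpan {N : AddSubgroup (LaurentSeries ℤ)}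
    (f : LaurentSeries ℤ →+ LaurentSeries ℤ)
    (h : ∀ j, J j → f (5 ^ w j * ((φ ^ j : (LaurentSeries ℤ)ˣ) : LaurentSeries ℤ)) ∈ N)
    {x : LaurentSeries ℤ} (hx : x ∈ powSpan φ w J) : f x ∈ N := by
  have : powSpan φ w J ≤ N.comap f := by
    rw [powSpan, AddSubgroup.closure_le]
    rintro _ ⟨j, hj, rfl⟩
    exact h j hj
  exact this hx

theorem natCast_mul_mem {N : AddSubgroup (LaurentSeries ℤ)} (c : ℕ) {x : LaurentSeries ℤ}
    (hx : x ∈ N) : (c : LaurentSeries ℤ) * x ∈ N := by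
  rw [← nsmul_eq_mul]
  exact N.nsmul_mem hx c

theorem pow_mul_zpow_mem_powSpan {v : ℕ} {j : ℤ} (hj : J j) (hv : w j ≤ v) :
    5 ^ v * ((φ ^ j : (LaurentSeries ℤ)ˣ) : LaurentSeries ℤ) ∈ powSpan φ w J := by
  obtain ⟨k, rfl⟩ := Nat.exists_eq_add_of_le hv
  have := natCast_mul_mem (5 ^ k) (AddSubgroup.subset_closure (k := {x | ∃ j, J j ∧ x = 5 ^ w j *
      ((φ ^ j : (LaurentSeries ℤ)ˣ) : LaurentSeries ℤ)})
    ⟨j, hj, rfl⟩)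
  rw [powSpan]
  convert this using 1
  push_cast
  ring

theorem mul_mem_powSpan (v : ℕ) (d : ℤ) (h : ∀ j, J j → J' (j + d) ∧ w' (j + d) ≤ v + w j)
    {x : LaurentSeries ℤ} (hx : x ∈ powSpan φ w J) :
    5 ^ v * ((φ ^ d : (LaurentSeries ℤ)ˣ) : LaurentSeries ℤ) * x ∈ powSpan φ w' J' := by
  refine map_mem_of_mem_powSpan
    (AddMonoidHom.mulLeft (5 ^ v * ((φ ^ d : (LaurentSeries ℤ)ˣ) : LaurentSeries ℤ)))
    (fun j hj => ?_) hx
  have := pow_mul_zpow_mem_powSpan (φ := φ) (h j hj).1 (h j hj).2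
  convert this using 1
  rw [_root_.zpow_add, AddMonoidHom.coe_mulLeft, Units.val_mul]
  ring

theorem powSpan_mono (h : ∀ j, J j → J' j ∧ w' j ≤ w j) : powSpan φ w J ≤ powSpan φ w' J' := by
  intro x hx
  have := mul_mem_powSpan (w' := w') (J' := J') 0 0 (by simpa using h) hx
  simpa using this

theorem U5_pow_mul (v : ℕ) (x : LaurentSeries ℤ) : U5 (5 ^ v * x) = 5 ^ v * U5 x := by
  have := map_nsmul U5 (5 ^ v) x
  simpa [nsmul_eq_mul] using this

theorem coeff_pow_five_mul (v : ℕ) (x : LaurentSeries ℤ) (n : ℤ) :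
    (5 ^ v * x).coeff n = 5 ^ v * x.coeff n := by
  have := coeff_intCast_mul (5 ^ v) x n
  simpa using this

/-- The span receiving `U5 (s ^ (-ν))`. -/
def spanS (φ : (LaurentSeries ℤ)ˣ) (ν : ℤ) : AddSubgroup (LaurentSeries ℤ) :=
  powSpan φ (fun j => ((5 * j - ν - 1) / 2).toNat) (fun j => ν ≤ 5 * j)

/-- The span of holomorphic elements divisible by `5 ^ k` in the adapted basis. -/
def spanX (φ : (LaurentSeries ℤ)ˣ) (k : ℕ) : AddSubgroup (LaurentSeries ℤ) :=
  powSpan φ (fun j => k + (5 * j / 2 - 2).toNat) (fun j => 1 ≤ j)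

namespace HauptmodulPair

variable {s t : (LaurentSeries ℤ)ˣ} (D : HauptmodulPair s t)
include D

theorem U5_zpow_succ {ν : ℤ} (h0 : U5 ((s ^ (-ν) : (LaurentSeries ℤ)ˣ) : LaurentSeries ℤ) ∈
    spanS t⁻¹ ν)
    (h1 : U5 ((s ^ (-(ν + 1)) : (LaurentSeries ℤ)ˣ) : LaurentSeries ℤ) ∈ spanS t⁻¹ (ν + 1))
    (h2 : U5 ((s ^ (-(ν + 2)) : (LaurentSeries ℤ)ˣ) : LaurentSeries ℤ) ∈ spanS t⁻¹ (ν + 2))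
    (h3 : U5 ((s ^ (-(ν + 3)) : (LaurentSeries ℤ)ˣ) : LaurentSeries ℤ) ∈ spanS t⁻¹ (ν + 3))
    (h4 : U5 ((s ^ (-(ν + 4)) : (LaurentSeries ℤ)ˣ) : LaurentSeries ℤ) ∈ spanS t⁻¹ (ν + 4)) :
    U5 ((s ^ (-(ν + 5)) : (LaurentSeries ℤ)ˣ) : LaurentSeries ℤ) ∈ spanS t⁻¹ (ν + 5) := by
  have h := D.U5_pow_rec (-(ν + 5))
  have key : U5 ((s ^ (-(ν + 5)) : (LaurentSeries ℤ)ˣ) : LaurentSeries ℤ) =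
      (((t⁻¹ : (LaurentSeries ℤ)ˣ) : LaurentSeries ℤ)) * (t *
          U5 ((s ^ (-(ν + 5)) : (LaurentSeries ℤ)ˣ) : LaurentSeries ℤ)) := by
    rw [← mul_assoc, Units.inv_mul, one_mul]
  rw [key, h]
  rw [show -(ν + 5) + 5 = -ν by ring, show -(ν + 5) + 4 = -(ν + 1) by ring,
    show -(ν + 5) + 3 = -(ν + 2) by ring, show -(ν + 5) + 2 = -(ν + 3) by ring,
    show -(ν + 5) + 1 = -(ν + 4) by ring]
  have m0 := mul_mem_powSpan (φ := t⁻¹) (w' := fun j => ((5 * j - (ν + 5) - 1) / 2).toNat)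
    (J' := fun j => (ν + 5) ≤ 5 * j) 0 1 (by intro j hj; omega) h0
  have m1 := mul_mem_powSpan (φ := t⁻¹) (w' := fun j => ((5 * j - (ν + 5) - 1) / 2).toNat)
    (J' := fun j => (ν + 5) ≤ 5 * j) 1 1 (by intro j hj; omega) h1
  have m2 := natCast_mul_mem 3 (mul_mem_powSpan (φ := t⁻¹) (w' := fun j => ((5 *
      j - (ν + 5) - 1) / 2).toNat)
    (J' := fun j => (ν + 5) ≤ 5 * j) 1 1 (by intro j hj; omega) h2)
  have m3 := mul_mem_powSpan (φ := t⁻¹) (w' := fun j => ((5 * j - (ν + 5) - 1) / 2).toNat)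
    (J' := fun j => (ν + 5) ≤ 5 * j) 2 1 (by intro j hj; omega) h3
  have m4 := mul_mem_powSpan (φ := t⁻¹) (w' := fun j => ((5 * j - (ν + 5) - 1) / 2).toNat)
    (J' := fun j => (ν + 5) ≤ 5 * j) 2 1 (by intro j hj; omega) h4
  have := add_mem (add_mem (add_mem (add_mem m0 m1) m2) m3) m4
  rw [spanS]
  convert this using 1
  rw [zpow_one]
  push_cast
  ring

theorem U5_zpow_pred {ν : ℤ} (h5 : U5 ((s ^ (-(ν + 5)) : (LaurentSeries ℤ)ˣ) : LaurentSeries ℤ) ∈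
    spanS t⁻¹ (ν + 5))
    (h1 : U5 ((s ^ (-(ν + 1)) : (LaurentSeries ℤ)ˣ) : LaurentSeries ℤ) ∈ spanS t⁻¹ (ν + 1))
    (h2 : U5 ((s ^ (-(ν + 2)) : (LaurentSeries ℤ)ˣ) : LaurentSeries ℤ) ∈ spanS t⁻¹ (ν + 2))
    (h3 : U5 ((s ^ (-(ν + 3)) : (LaurentSeries ℤ)ˣ) : LaurentSeries ℤ) ∈ spanS t⁻¹ (ν + 3))
    (h4 : U5 ((s ^ (-(ν + 4)) : (LaurentSeries ℤ)ˣ) : LaurentSeries ℤ) ∈ spanS t⁻¹ (ν + 4)) :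
    U5 ((s ^ (-ν) : (LaurentSeries ℤ)ˣ) : LaurentSeries ℤ) ∈ spanS t⁻¹ ν := by
  have h := D.U5_pow_rec (-(ν + 5))
  rw [show -(ν + 5) + 5 = -ν by ring, show -(ν + 5) + 4 = -(ν + 1) by ring,
    show -(ν + 5) + 3 = -(ν + 2) by ring, show -(ν + 5) + 2 = -(ν + 3) by ring,
    show -(ν + 5) + 1 = -(ν + 4) by ring] at h
  have m0 := mul_mem_powSpan (φ := t⁻¹) (w' := fun j => ((5 * j - ν - 1) / 2).toNat)
    (J' := fun j => ν ≤ 5 * j) 0 (-1) (by intro j hj; omega) h5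
  have m1 := mul_mem_powSpan (φ := t⁻¹) (w' := fun j => ((5 * j - ν - 1) / 2).toNat)
    (J' := fun j => ν ≤ 5 * j) 1 0 (by intro j hj; omega) h1
  have m2 := natCast_mul_mem 3 (mul_mem_powSpan (φ := t⁻¹) (w' := fun j => ((5 *
      j - ν - 1) / 2).toNat)
    (J' := fun j => ν ≤ 5 * j) 1 0 (by intro j hj; omega) h2)
  have m3 := mul_mem_powSpan (φ := t⁻¹) (w' := fun j => ((5 * j - ν - 1) / 2).toNat)
    (J' := fun j => ν ≤ 5 * j) 2 0 (by intro j hj; omega) h3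
  have m4 := mul_mem_powSpan (φ := t⁻¹) (w' := fun j => ((5 * j - ν - 1) / 2).toNat)
    (J' := fun j => ν ≤ 5 * j) 2 0 (by intro j hj; omega) h4
  have := sub_mem (sub_mem (sub_mem (sub_mem m0 m1) m2) m3) m4
  rw [spanS]
  convert this using 1
  rw [_root_.zpow_neg_one, inv_inv, zpow_zero]
  push_cast
  linear_combination -h

theorem U5_s_zpow_base : ∀ i : ℕ,
    i < 5 → U5 ((s ^ (i : ℤ) : (LaurentSeries ℤ)ˣ) : LaurentSeries ℤ) ∈
    spanS t⁻¹ (-i) := by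
  obtain ⟨c2, c3, c4⟩ := D.s_pow_coeffs
  have key : ∀ i : ℕ, ∀ a : ℤ, ∀ v : ℕ, ((i : ℤ) - 1) / 2 ≤ v → 
      U5 ((s ^ (i : ℤ) : (LaurentSeries ℤ)ˣ) : LaurentSeries ℤ) = a * 5 ^ v →
      U5 ((s ^ (i : ℤ) : (LaurentSeries ℤ)ˣ) : LaurentSeries ℤ) ∈ spanS t⁻¹ (-i) := by
    intro i a v hv h
    rw [h, ← zsmul_eq_mul]
    refine zsmul_mem ?_ a
    have := pow_mul_zpow_mem_powSpan (φ := t⁻¹) (v := v) (j := 0)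
      (w := fun j => ((5 * j - -(i : ℤ) - 1) / 2).toNat) (J := fun j => -(i : ℤ) ≤ 5 * j)
      (by simp) (by omega)
    simpa [spanS] using this
  intro i hi
  have e := fun h0 => D.U5_pow_eq (k := i) h0 hi
  simp only [zpow_natCast, Units.val_pow_eq_pow_val] at key ⊢
  interval_cases i
  · exact key 0 1 0 (by norm_num) (by simp [U5_one])
  · refine key 1 (-1) 0 (by norm_num) ?_
    rw [e (by norm_num), pow_one, D.s_zero]; simp
  · refine key 2 (-1) 0 (by norm_num) ?_
    rw [e (by norm_num), c2]; simp
  · refine key 3 1 1 (by norm_num) ?_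
    rw [e (by norm_num), c3]; simp
  · refine key 4 (-1) 1 (by norm_num) ?_
    rw [e (by norm_num), c4]; simp

theorem U5_s_zpow_mem (ν : ℤ) : U5 ((s ^ (-ν) : (LaurentSeries ℤ)ˣ) : LaurentSeries ℤ) ∈
    spanS t⁻¹ ν := by
  let P : ℤ → Prop := fun ν =>
    U5 ((s ^ (-ν) : (LaurentSeries ℤ)ˣ) : LaurentSeries ℤ) ∈ spanS t⁻¹ ν
  have hP : ∀ {μ ν : ℤ}, P μ → μ = ν → P ν := fun h e => e ▸ h
  suffices H : ∀ n : ℤ, ∀ i : ℕ, i < 5 → P (n - 4 + i) from hP (H ν 4 (by norm_num)) (by simp)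
  intro n
  induction n using Int.induction_on with
  | zero =>
    intro i hi
    have h : P (-((4 - i : ℕ) : ℤ)) := by
      have := D.U5_s_zpow_base (4 - i) (by omega)
      simp only [P]
      rwa [neg_neg]
    exact hP h (by omega)
  | succ n ih =>
    intro i hi
    rcases lt_or_eq_of_le (show i ≤ 4 by omega) with h | rfl
    · exact hP (ih (i + 1) (by omega)) (by push_cast; ring)
    · exact hP (D.U5_zpow_succ (ν := n - 4) (hP (ih 0 (by norm_num)) (by simp))
        (ih 1 (by norm_num)) (ih 2 (by norm_num)) (ih 3 (by norm_num)) (ih 4 (by norm_num)))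
        (by push_cast; ring)
  | pred n ih =>
    intro i hi
    rcases i with _ | i
    · exact hP (D.U5_zpow_pred (ν := -n - 1 - 4) (hP (ih 4 (by norm_num)) (by push_cast; ring))
        (hP (ih 0 (by norm_num)) (by push_cast; ring))
        (hP (ih 1 (by norm_num)) (by push_cast; ring))
        (hP (ih 2 (by norm_num)) (by push_cast; ring))
        (hP (ih 3 (by norm_num)) (by push_cast; ring))) (by simp)
    · exact hP (ih i (by omega)) (by push_cast; ring)

theorem U5_t_zpow_mem (k : ℤ) : U5 (((t⁻¹) ^ k : (LaurentSeries ℤ)ˣ) : LaurentSeries ℤ) ∈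
    powSpan t⁻¹ (fun j => ((5 * j - k - 1) / 2).toNat) (fun j => k ≤ 5 * j) := by
  have hu : t * Units.map (V5 : LaurentSeries ℤ →* LaurentSeries ℤ) t = s ^ 6 := by
    ext1
    simpa using D.t_mul_V5_t
  have h1 : (t⁻¹) ^ k = Units.map (V5 : LaurentSeries ℤ →* LaurentSeries ℤ) (t ^ k) * s ^ (-(6 *
      k)) := by
    rw [_root_.zpow_neg, _root_.zpow_mul, show s ^ (6 : ℤ) = s ^ 6 from rfl, ← hu, mul_zpow,
        map_zpow, mul_inv]
    rw [mul_comm, mul_assoc, inv_mul_cancel, mul_one, _root_.inv_zpow]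
  rw [h1, Units.val_mul, Units.coe_map, MonoidHom.coe_coe, U5_V5_mul]
  have := mul_mem_powSpan (φ := t⁻¹) (w' := fun j => ((5 * j - k - 1) / 2).toNat)
    (J' := fun j => k ≤ 5 * j) 0 (-k) (by intro j hj; omega) (D.U5_s_zpow_mem (6 * k))
  simpa using this

theorem U5_mem_spanX {k : ℕ} {x : LaurentSeries ℤ} (hx : x ∈ spanX t⁻¹ k) :
    U5 x ∈ spanX t⁻¹ (k + 1) := by
  refine map_mem_of_mem_powSpan U5 (fun j hj => ?_) hx
  rw [U5_pow_mul]
  have := mul_mem_powSpan (φ := t⁻¹) (w' := fun j => k + 1 + (5 * j / 2 - 2).toNat)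
    (J' := fun j => 1 ≤ j) (k + (5 * j / 2 - 2).toNat) 0
    (by intro i hi; omega) (D.U5_t_zpow_mem j)
  simpa [spanX] using this

theorem U5_iterate_mem_spanX (b : ℕ) {k : ℕ} {x : LaurentSeries ℤ} (hx : x ∈ spanX t⁻¹ k) :
    U5^[b] x ∈ spanX t⁻¹ (k + b) := by
  induction b with
  | zero => exact hx
  | succ b ih =>
    rw [Function.iterate_succ_apply']
    exact D.U5_mem_spanX ih

theorem dvd_coeff_of_mem_spanX {k : ℕ} {x : LaurentSeries ℤ} (hx : x ∈ spanX t⁻¹ k) :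
    (∀ n ≤ 0, x.coeff n = 0) ∧ ∀ n, (5 : ℤ) ^ k ∣ x.coeff n := by
  rw [spanX, powSpan] at hx
  induction hx using AddSubgroup.closure_induction with
  | mem x hx =>
    obtain ⟨j, hj, rfl⟩ := hx
    lift j to ℕ using by omega
    have := coeff_pow_eq_zero_of_lt D.t_inv_lt j
    refine ⟨fun n hn => ?_, fun n => ?_⟩
    · rw [coeff_pow_five_mul, zpow_natCast, Units.val_pow_eq_pow_val, this _ (by omega), mul_zero]
    · rw [coeff_pow_five_mul, pow_add, mul_assoc]
      exact dvd_mul_right _ _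
  | zero => simp
  | add x y _ _ hx hy =>
    exact ⟨fun n hn => by simp [hx.1 n hn, hy.1 n hn], fun n => dvd_add (hx.2 n) (hy.2 n)⟩
  | neg x _ hx =>
    exact ⟨fun n hn => by simp [hx.1 n hn], fun n => (dvd_neg).2 (hx.2 n)⟩

end HauptmodulPair
end FormalLaurent

namespace FormalLaurent
namespace HauptmodulPair

variable {s t : (LaurentSeries ℤ)ˣ} (D : HauptmodulPair s t)
include D

theorem U5_s_pow_mem_range (n : ℕ) : U5 ((s : LaurentSeries ℤ) ^ n) ∈
    (evalInt (t : LaurentSeries ℤ)).range := by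
  induction n using Nat.strong_induction_on with
  | _ n ih =>
    rcases lt_or_ge n 5 with h | h
    · rcases Nat.eq_zero_or_pos n with rfl | h0
      · rw [pow_zero, U5_one]; exact one_mem _
      · rw [D.U5_pow_eq h0 h]; exact intCast_mem _ _
    · obtain ⟨k, rfl⟩ := Nat.exists_eq_add_of_le' h
      have hrec := D.U5_pow_rec k
      norm_cast at hrec
      simp only [Units.val_pow_eq_pow_val] at hrec
      have hs : U5 ((s : LaurentSeries ℤ) ^ (k + 5)) = t * U5 ((s : LaurentSeries ℤ) ^ k)
          - ((5 : ℕ) : LaurentSeries ℤ) * U5 ((s : LaurentSeries ℤ) ^ (k + 4))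
          - ((15 : ℕ) : LaurentSeries ℤ) * U5 ((s : LaurentSeries ℤ) ^ (k + 3))
          - ((25 : ℕ) : LaurentSeries ℤ) * U5 ((s : LaurentSeries ℤ) ^ (k + 2))
          - ((25 : ℕ) : LaurentSeries ℤ) * U5 ((s : LaurentSeries ℤ) ^ (k + 1)) := by
        rw [hrec]; push_cast; ring
      rw [hs]
      have ht : (t : LaurentSeries ℤ) ∈ (evalInt (t : LaurentSeries ℤ)).range :=
        ⟨Polynomial.X, evalInt_X _⟩
      have hn := fun c : ℕ => natCast_mem (evalInt (t : LaurentSeries ℤ)).range c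
      exact sub_mem (sub_mem (sub_mem (sub_mem (mul_mem ht (ih _ (by omega)))
        (mul_mem (hn _) (ih _ (by omega)))) (mul_mem (hn _) (ih _ (by omega))))
        (mul_mem (hn _) (ih _ (by omega)))) (mul_mem (hn _) (ih _ (by omega)))

omit D in
theorem map_evalInt_mem {N : AddSubgroup (LaurentSeries ℤ)} (x : LaurentSeries ℤ)
    (h : ∀ n : ℕ, U5 (x ^ n) ∈ N) (p : Polynomial ℤ) : U5 (evalInt x p) ∈ N := by
  induction p using Polynomial.induction_on' with
  | add p q hp hq => rw [map_add, map_add]; exact add_mem hp hq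
  | monomial n a =>
    rw [evalInt_monomial, ← zsmul_eq_mul, map_zsmul]
    exact N.zsmul_mem (h n) a

theorem U5_evalInt_s_mem_range (p : Polynomial ℤ) : U5 (evalInt s p) ∈
    (evalInt (t : LaurentSeries ℤ)).range :=
  map_evalInt_mem (N := (evalInt (t : LaurentSeries ℤ)).range.toAddSubgroup) _
    D.U5_s_pow_mem_range p

theorem U5_evalInt_t (p : Polynomial ℤ) : ∃ r : Polynomial ℤ, ∃ g ∈ spanX t⁻¹ 2,
    U5 (evalInt t p) = evalInt t r + g := by
  have key : U5 (evalInt t p) ∈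
      (evalInt (t : LaurentSeries ℤ)).range.toAddSubgroup ⊔ spanX t⁻¹ 2 := by
    refine map_evalInt_mem _ (fun n => ?_) p
    rcases Nat.eq_zero_or_pos n with rfl | hn
    · rw [pow_zero, U5_one]
      exact AddSubgroup.mem_sup_left (one_mem (evalInt (t : LaurentSeries ℤ)).range)
    · have h := D.U5_t_zpow_mem (-n)
      rw [_root_.zpow_neg, _root_.inv_zpow, inv_inv, zpow_natCast, Units.val_pow_eq_pow_val] at h
      refine (?_ : powSpan t⁻¹ (fun j => ((5 * j - -(n : ℤ) - 1) / 2).toNat)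
          (fun j => -(n : ℤ) ≤ 5 * j)
        ≤ _) h
      rw [powSpan, AddSubgroup.closure_le]
      rintro _ ⟨j, hj, rfl⟩
      rcases le_or_gt j 0 with hj0 | hj0
      · obtain ⟨k, rfl⟩ := (⟨j.natAbs, by omega⟩ : ∃ k : ℕ, j = -(k : ℤ))
        refine AddSubgroup.mem_sup_left ⟨5 ^ ((5 * (-(k : ℤ)) - -(n : ℤ) - 1) / 2).toNat *
            Polynomial.X ^ k, ?_⟩
        rw [map_mul, map_pow, map_pow, evalInt_X]
        congr 2
        · exact map_natCast _ 5
        · simp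
      · refine AddSubgroup.mem_sup_right (pow_mul_zpow_mem_powSpan (by omega) ?_)
        omega
  obtain ⟨_, ⟨r, rfl⟩, g, hg, h⟩ := AddSubgroup.mem_sup.mp key
  exact ⟨r, g, hg, h.symm⟩

/-- If the principal part of `U5 x` agrees with `y`, for `x, y` polynomials in `t`, then the
difference is highly divisible. -/
theorem U5_evalInt_t_sub_mem {p r : Polynomial ℤ}
    (h : ∀ n ≤ 0, (U5 (evalInt t p)).coeff n = (evalInt (t : LaurentSeries ℤ) r).coeff n) :
    U5 (evalInt t p) - evalInt t r ∈ spanX t⁻¹ 2 := by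
  obtain ⟨r', g, hg, hU⟩ := D.U5_evalInt_t p
  have h0 : r' - r = 0 := by
    refine evalInt_eq_zero D.t_lt D.t_neg_one _ fun n hn => ?_
    have h1 := h n hn
    rw [hU, HahnSeries.coeff_add, (D.dvd_coeff_of_mem_spanX hg).1 n hn, add_zero] at h1
    rw [map_sub, HahnSeries.coeff_sub, h1, sub_self]
  rw [hU, ← sub_eq_zero.mp h0, add_sub_cancel_left]
  exact hg

/-- `f` is the member of the reduced basis with leading exponent `-m` and coefficients `a m`. -/
theorem pow_dvd_coeff {a : ℕ → ℕ → ℤ} {p : ℕ → Polynomial ℤ}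
    (h1 : ∀ m, 1 ≤ m → ∀ n : ℤ, n ≤ 0 → (evalInt (s : LaurentSeries ℤ) (p m)).coeff n = if n =
        -m then 1 else 0)
    (h2 : ∀ m, 1 ≤ m → ∀ n : ℕ, 1 ≤ n → (evalInt (s : LaurentSeries ℤ) (p m)).coeff n = a m n) :
    ∀ α β m' n' : ℕ, ¬ 5 ∣ m' → ¬ 5 ∣ n' →
      (β < α → (5 : ℤ) ^ (2 * (α - β) + 1) ∣ a (5 ^ α * m') (5 ^ β * n')) ∧
      (α < β → (5 : ℤ) ^ ((β - α) + 1) ∣ a (5 ^ α * m') (5 ^ β * n')) := by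
  have duality : ∀ m n : ℕ, 1 ≤ m → 1 ≤ n → (n : ℤ) * a m n = m * a n m := by
    intro m n hm hn
    have hlow : ∀ k : ℕ, 1 ≤ k → ∀ i < -(k : ℤ), (evalInt (s : LaurentSeries ℤ) (p k)).coeff i =
        0 :=
      fun k hk i hi => by rw [h1 k hk i (by omega), if_neg (by omega)]
    have hth : ∀ i < -(n : ℤ), (theta (evalInt (s : LaurentSeries ℤ) (p n))).coeff i = 0 :=
      fun i hi => by rw [coeff_theta, hlow n hn i hi, mul_zero]
    have h := coeff_zero_evalInt_mul_theta_evalInt (s : LaurentSeries ℤ) (p m) (p n)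
    rw [coeff_mul_eq_sum (hlow m hm) hth, ← Finset.sum_subset
      (show ({-(m : ℤ), (n : ℤ)} : Finset ℤ) ⊆ _ from ?_) ?_, Finset.sum_pair (by omega)] at h
    · simp only [coeff_theta, zero_sub, neg_neg] at h
      rw [h1 m hm _ (by omega), if_pos rfl, h2 n hn m hm, h2 m hm n hn, h1 n hn _ (by omega),
        if_pos rfl] at h
      linarith
    · intro i hi
      simp only [Finset.mem_insert, Finset.mem_singleton] at hi
      rw [Finset.mem_Icc]
      omega
    · intro i _ hi
      simp only [Finset.mem_insert, Finset.mem_singleton, not_or] at hi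
      rw [coeff_theta]
      rcases lt_trichotomy i 0 with h0 | rfl | h0
      · rw [h1 m hm i h0.le, if_neg hi.1, zero_mul]
      · simp
      · rw [h1 n hn _ (by omega), if_neg (by omega), mul_zero, mul_zero]
  have hU : ∀ m, 1 ≤ m → ∀ n ≤ 0, (U5 (evalInt (s : LaurentSeries ℤ) (p (5 * m)))).coeff n =
      if n = -m then 1 else 0 := by
    intro m hm n hn
    rw [coeff_U5, h1 _ (by omega) _ (by omega)]
    refine if_congr ?_ rfl rfl
    push_cast
    omega
  have hU0 : ∀ m, 1 ≤ m → ¬ 5 ∣ m → U5 (evalInt (s : LaurentSeries ℤ) (p m)) = 0 := by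
    intro m hm h5
    obtain ⟨r, hr⟩ := D.U5_evalInt_s_mem_range (p m)
    rw [← hr, evalInt_eq_zero D.t_lt D.t_neg_one r, map_zero]
    intro n hn
    rw [hr, coeff_U5, h1 m hm _ (by omega), if_neg (by omega)]
  have hmem : ∀ a' : ℕ, ∀ m' : ℕ, 1 ≤ m' → ¬ 5 ∣ m' → ∀ c : ℕ,
      U5^[a' + 1 + c] (U5 (evalInt (s : LaurentSeries ℤ) (p (5 * (5 ^ a' * m'))))) ∈
          spanX t⁻¹ (c + 2) := by
    intro a'
    induction a' with
    | zero =>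
      intro m' hm' h5 c
      obtain ⟨r, hr⟩ := D.U5_evalInt_s_mem_range (p (5 * (5 ^ 0 * m')))
      have h := D.U5_evalInt_t_sub_mem (p := r) (r := 0) fun n hn => by
        rw [hr, coeff_U5, hU _ (by omega) _ (by omega), if_neg (by omega)]
        simp
      rw [map_zero, sub_zero, hr] at h
      rw [zero_add, add_comm 1 c, Function.iterate_succ_apply, add_comm c]
      exact D.U5_iterate_mem_spanX c h
    | succ a' ih =>
      intro m' hm' h5 c
      have hpos : 1 ≤ 5 ^ a' * m' := Nat.succ_le_of_lt (by positivity)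
      obtain ⟨r, hr⟩ := D.U5_evalInt_s_mem_range (p (5 * (5 ^ (a' + 1) * m')))
      obtain ⟨r', hr'⟩ := D.U5_evalInt_s_mem_range (p (5 * (5 ^ a' * m')))
      have h := D.U5_evalInt_t_sub_mem (p := r) (r := r') fun n hn => by
        rw [hr, hr', coeff_U5, hU _ (Nat.succ_le_of_lt (by positivity)) _ (by omega),
            hU _ hpos _ hn]
        refine if_congr ?_ rfl rfl
        push_cast
        rw [pow_succ]
        constructor <;> intro h <;> linarith
      rw [hr, hr'] at h
      have h3 := D.U5_iterate_mem_spanX (a' + 1 + c) h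
      have h4 := ih m' hm' h5 c
      rw [show a' + 1 + 1 + c = (a' + 1 + c) + 1 by ring, Function.iterate_succ_apply]
      have h5 : ∀ b, ∀ x y : LaurentSeries ℤ, U5^[b] (x - y) = U5^[b] x - U5^[b] y :=
        fun b x y => iterate_map_sub U5 b x y
      rw [h5] at h3
      have h6 : spanX t⁻¹ (2 + (a' + 1 + c)) ≤ spanX t⁻¹ (c + 2) :=
        powSpan_mono fun j hj => ⟨hj, by omega⟩
      have := add_mem (h6 h3) h4
      rwa [sub_add_cancel] at this
  have lower : ∀ α β m' n' : ℕ, ¬ 5 ∣ m' → ¬ 5 ∣ n' → α < β →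
      (5 : ℤ) ^ ((β - α) + 1) ∣ a (5 ^ α * m') (5 ^ β * n') := by
    intro α β m' n' hm hn hαβ
    have hm1 : 1 ≤ m' := Nat.one_le_iff_ne_zero.2 (by rintro rfl; exact hm (dvd_zero _))
    have hn1 : 1 ≤ n' := Nat.one_le_iff_ne_zero.2 (by rintro rfl; exact hn (dvd_zero _))
    have hmα : 1 ≤ 5 ^ α * m' := Nat.succ_le_of_lt (by positivity)
    have hnβ : 1 ≤ 5 ^ β * n' := Nat.succ_le_of_lt (by positivity)
    rw [← h2 _ hmα _ hnβ]
    cases α with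
    | zero =>
      obtain ⟨b, rfl⟩ := Nat.exists_eq_add_of_lt hαβ
      have := congrArg (fun x => HahnSeries.coeff x ((5 ^ b * n' : ℕ) : ℤ)) (hU0 m' hm1 hm)
      simp only [coeff_U5, HahnSeries.coeff_zero] at this
      rw [pow_zero, one_mul, show ((5 ^ (0 + b + 1) * n' : ℕ) : ℤ) = 5 * ((5 ^ b * n' : ℕ) : ℤ) by
        push_cast; ring, this]
      exact dvd_zero _
    | succ a' =>
      obtain ⟨c, rfl⟩ := Nat.exists_eq_add_of_lt hαβ
      have h := (D.dvd_coeff_of_mem_spanX (hmem a' m' hm1 hm c)).2 n'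
      rw [coeff_U5_iterate, coeff_U5] at h
      convert h using 2
      · omega
      · congr 2; ring
      · push_cast; ring
  intro α β m' n' hm hn
  refine ⟨fun h => ?_, lower α β m' n' hm hn⟩
  have hm1 : 1 ≤ m' := Nat.one_le_iff_ne_zero.2 (by rintro rfl; exact hm (dvd_zero _))
  have hn1 : 1 ≤ n' := Nat.one_le_iff_ne_zero.2 (by rintro rfl; exact hn (dvd_zero _))
  obtain ⟨c, rfl⟩ := Nat.exists_eq_add_of_lt h
  have hd := duality (5 ^ (β + c + 1) * m') (5 ^ β * n') (Nat.succ_le_of_lt (by positivity))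
    (Nat.succ_le_of_lt (by positivity))
  obtain ⟨d, hd2⟩ := lower β (β + c + 1) n' m' hn hm h
  rw [hd2] at hd
  have h5 : (5 : ℤ) ^ β ≠ 0 := by positivity
  have hd3 : (n' : ℤ) * a (5 ^ (β + c + 1) * m') (5 ^ β * n') =
      5 ^ (2 * (β + c + 1 - β) + 1) * (m' * d) := by
    apply mul_left_cancel₀ h5
    rw [show β + c + 1 - β = c + 1 by omega] at hd ⊢
    push_cast at hd
    calc _ = (5 : ℤ) ^ β * n' * a (5 ^ (β + c + 1) * m') (5 ^ β * n') := by ring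
      _ = _ := hd
      _ = _ := by ring
  have hcop : IsCoprime ((5 : ℤ) ^ (2 * (β + c + 1 - β) + 1)) (n' : ℤ) := by
    apply IsCoprime.pow_left
    rw [show (5 : ℤ) = ((5 : ℕ) : ℤ) by rfl, Nat.isCoprime_iff_coprime]
    exact (Nat.Prime.coprime_iff_not_dvd (by norm_num)).2 hn
  exact hcop.dvd_of_dvd_mul_left ⟨_, hd3⟩

end HauptmodulPair
end FormalLaurent

namespace FormalLaurent
open PowerSeries

theorem isUnit_of_constantCoeff_eq_one {f : PowerSeries ℤ} (hf : constantCoeff f = 1) : IsUnit f :=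
  PowerSeries.isUnit_iff_constantCoeff.mpr (by rw [hf]; exact isUnit_one)

/-- The unit `q⁻¹ f` of the ring of Laurent series. -/
noncomputable def unitOfPowerSeries (f : (PowerSeries ℤ)ˣ) : (LaurentSeries ℤ)ˣ :=
  ⟨HahnSeries.single (-1) 1 * HahnSeries.ofPowerSeries ℤ ℤ f,
    HahnSeries.single 1 1 * HahnSeries.ofPowerSeries ℤ ℤ (f⁻¹ : (PowerSeries ℤ)ˣ),
    by rw [mul_mul_mul_comm, HahnSeries.single_mul_single, ← map_mul, Units.mul_inv]; simp,
    by rw [mul_mul_mul_comm, HahnSeries.single_mul_single, ← map_mul, Units.inv_mul]; simp⟩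

theorem coeff_single_mul_ofPowerSeries (k : ℤ) (f : PowerSeries ℤ) (n : ℤ) :
    (HahnSeries.single k (1 : ℤ) * HahnSeries.ofPowerSeries ℤ ℤ f).coeff n =
      if n < k then 0 else PowerSeries.coeff (n - k).natAbs f := by
  rw [HahnSeries.coeff_single_mul, one_mul, PowerSeries.coeff_coe]
  refine if_congr (by omega) rfl rfl

theorem single_neg_one_pow (k : ℕ) :
    (HahnSeries.single (-1 : ℤ) (1 : ℤ)) ^ k = HahnSeries.single (-(k : ℤ)) 1 := by
  rw [HahnSeries.single_pow]
  simp

theorem exists_hauptmodulPair {e u : PowerSeries ℤ} (e0 : coeff 0 e = 1) (e1 : coeff 1 e = -1)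
    (e2 : coeff 2 e = -1) (e3 : coeff 3 e = 0) (e4 : coeff 4 e = 0)
    (h1 : u * expand 25 (by norm_num) e = e)
    (h2 : (u ^ 5 + 5 * X * u ^ 4 + 15 * X ^ 2 * u ^ 3 + 25 * X ^ 3 * u ^ 2 + 25 * X ^ 4 * u)
      * expand 25 (by norm_num) e ^ 6 = expand 5 (by norm_num) e ^ 6) :
    ∃ s t : (LaurentSeries ℤ)ˣ, HauptmodulPair s t ∧
      (s : LaurentSeries ℤ) = HahnSeries.single (-1) 1 * HahnSeries.ofPowerSeries ℤ ℤ u := by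
  have hcoeff : ∀ n < 25, coeff n u = coeff n e := by
    intro n hn
    rw [← h1, PowerSeries.coeff_mul, Finset.sum_eq_single (n, 0)]
    · simp [coeff_expand, e0]
    · rintro ⟨i, j⟩ hij hne
      rw [Finset.HasAntidiagonal.mem_antidiagonal] at hij
      rw [coeff_expand_of_not_dvd, mul_zero]
      rintro ⟨k, rfl⟩
      simp only at hij
      have : k = 0 := by omega
      subst this
      exact hne (by ext <;> simp; omega)
    · simp
  have he : constantCoeff e = 1 := by rw [← coeff_zero_eq_constantCoeff_apply, e0]
  have hu : constantCoeff u = 1 := by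
    rw [← coeff_zero_eq_constantCoeff_apply, hcoeff 0 (by norm_num), e0]
  obtain ⟨u', hu'⟩ := isUnit_of_constantCoeff_eq_one hu
  obtain ⟨e', he'⟩ := isUnit_of_constantCoeff_eq_one he
  let E5 : (PowerSeries ℤ)ˣ := Units.map (expand 5 (by norm_num) : PowerSeries ℤ →ₐ[ℤ]
      PowerSeries ℤ).toRingHom.toMonoidHom e'
  let T : (PowerSeries ℤ)ˣ := e' ^ 6 * (E5⁻¹) ^ 6
  have hE5 : (E5 : PowerSeries ℤ) = expand 5 (by norm_num) e := by rw [← he']; rfl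
  have hT : (T : PowerSeries ℤ) * expand 5 (by norm_num) e ^ 6 = e ^ 6 := by
    rw [← hE5, ← he', ← Units.val_pow_eq_pow_val, ← Units.val_mul]
    simp only [T, inv_pow, inv_mul_cancel_right, Units.val_pow_eq_pow_val]
  have hT0 : constantCoeff (T : PowerSeries ℤ) = 1 := by
    have := congrArg constantCoeff hT
    rw [map_mul, map_pow, map_pow, constantCoeff_expand, he] at this
    simpa using this
  have hne : expand 25 (by norm_num) e ≠ 0 := by
    intro h
    have := congrArg constantCoeff h
    rw [constantCoeff_expand, he] at this
    simp at this
  have hne5 : expand 5 (by norm_num) e ≠ 0 := by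
    intro h
    have := congrArg constantCoeff h
    rw [constantCoeff_expand, he] at this
    simp at this
  have h25 : expand 5 (by norm_num) (expand 5 (by norm_num) e) = expand 25 (by norm_num) e :=
    (expand_mul 5 (by norm_num) 5 (by norm_num) e).symm
  have hVT : expand 5 (by norm_num) (T : PowerSeries ℤ) =
      u ^ 5 + 5 * X * u ^ 4 + 15 * X ^ 2 * u ^ 3 + 25 * X ^ 3 * u ^ 2 + 25 * X ^ 4 * u := by
    have h := congrArg (expand 5 (by norm_num)) hT
    rw [map_mul, map_pow, map_pow, h25, ← h2] at h
    exact mul_right_cancel₀ (pow_ne_zero 6 hne) h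
  have hprod : (T : PowerSeries ℤ) * expand 5 (by norm_num) (T : PowerSeries ℤ) = u ^ 6 := by
    have h := congrArg (expand 5 (by norm_num)) hT
    rw [map_mul, map_pow, map_pow, h25] at h
    apply mul_right_cancel₀ (pow_ne_zero 6 hne)
    apply mul_right_cancel₀ (pow_ne_zero 6 hne5)
    rw [← mul_pow u, h1, ← hT, mul_assoc _ (expand 5 _ _), h]
  have hs : ∀ n, (unitOfPowerSeries u' : LaurentSeries ℤ).coeff n =
      if n < -1 then 0 else PowerSeries.coeff (n - -1).natAbs u := fun n => by
    rw [← hu']; exact coeff_single_mul_ofPowerSeries _ _ _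
  have ht : ∀ n, (unitOfPowerSeries T : LaurentSeries ℤ).coeff n =
      if n < -1 then 0 else PowerSeries.coeff (n - -1).natAbs (T : PowerSeries ℤ) := fun n =>
    coeff_single_mul_ofPowerSeries _ _ _
  have hV : V5 (unitOfPowerSeries T : LaurentSeries ℤ) =
      HahnSeries.single (-5) 1 * HahnSeries.ofPowerSeries ℤ ℤ (expand 5 (by norm_num)
          (T : PowerSeries ℤ)) := by
    change V5 (HahnSeries.single (-1) 1 * HahnSeries.ofPowerSeries ℤ ℤ (T : PowerSeries ℤ)) = _
    rw [map_mul, V5_ofPowerSeries]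
    congr 1
    ext n
    by_cases h : 5 ∣ n
    · obtain ⟨k, rfl⟩ := h
      rw [coeff_V5_mul]
      by_cases hk : k = -1
      · subst hk; simp
      · rw [HahnSeries.coeff_single_of_ne hk, HahnSeries.coeff_single_of_ne (by omega)]
    · rw [coeff_V5_of_not_dvd _ h, HahnSeries.coeff_single_of_ne (by omega)]
  have hsv : (unitOfPowerSeries u' : LaurentSeries ℤ) =
      HahnSeries.single (-1) 1 * HahnSeries.ofPowerSeries ℤ ℤ u := by rw [← hu']; rfl
  refine ⟨unitOfPowerSeries u', unitOfPowerSeries T, ?_, hsv⟩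
  constructor
  · intro n hn; rw [hs, if_pos hn]
  · rw [hs]; simp [hu]
  · rw [hs]; simp [hcoeff, e1]
  · rw [hs]; simp [hcoeff, e2]
  · rw [hs]; simp [hcoeff, e3]
  · rw [hs]; simp [hcoeff, e4]
  · intro n hn; rw [ht, if_pos hn]
  · rw [ht]; simp [hT0]
  · intro n hn
    have := coeff_single_mul_ofPowerSeries 1 (T⁻¹ : (PowerSeries ℤ)ˣ) n
    rw [if_pos hn] at this
    exact this
  · rw [hV, hVT, hsv]
    simp only [map_add, map_mul, map_pow, mul_pow, map_ofNat]
    have hq : (HahnSeries.single (-1 : ℤ) (1 : ℤ)) * HahnSeries.ofPowerSeries ℤ ℤ X = 1 := by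
      rw [HahnSeries.ofPowerSeries_X, HahnSeries.single_mul_single]; simp
    have h5 : HahnSeries.single (-5 : ℤ) (1 : ℤ) = (HahnSeries.single (-1 : ℤ) (1 : ℤ)) ^ 5 := by
      rw [single_neg_one_pow]; rfl
    rw [h5]
    generalize (HahnSeries.single (-1 : ℤ) (1 : ℤ)) = y at hq
    generalize HahnSeries.ofPowerSeries ℤ ℤ X = x at hq
    generalize HahnSeries.ofPowerSeries ℤ ℤ u = v
    linear_combination (5 * v ^ 4 * y ^ 4 + 15 * v ^ 3 * y ^ 3 * (y * x + 1)
      + 25 * v ^ 2 * y ^ 2 * ((y * x) ^ 2 + y * x + 1)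
      + 25 * v * y * ((y * x) ^ 3 + (y * x) ^ 2 + y * x + 1)) * hq
  · rw [hV, hsv, mul_pow, single_neg_one_pow, ← map_pow, ← hprod, map_mul]
    change HahnSeries.single (-1) 1 * HahnSeries.ofPowerSeries ℤ ℤ (T : PowerSeries ℤ) * _ = _
    rw [mul_mul_mul_comm, HahnSeries.single_mul_single]
    norm_num

end FormalLaurent

namespace GammaZero

/-- A holomorphic function on the upper half plane, invariant under `Γ₀(25)` and bounded at every
cusp other than `∞`. -/
structure IsModularFun (f : ℍ → ℂ) : Prop where
  holo : MDifferentiable 𝓘(ℂ) 𝓘(ℂ) f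
  inv : ∀ γ : SL(2, ℤ), (25 : ℤ) ∣ γ 1 0 → ∀ z : ℍ, f (γ • z) = f z
  bdd : ∀ γ : SL(2, ℤ), ¬ (25 : ℤ) ∣ γ 1 0 → IsBoundedAtImInfty fun z => f (γ • z)

/-- `q ^ N * f` is the sum of the power series `c` evaluated at `q`. -/
def HasExp (f : ℍ → ℂ) (N : ℕ) (c : PowerSeries ℂ) : Prop :=
  ∀ z : ℍ, HasSum (fun n => PowerSeries.coeff n c * qq z ^ n) (qq z ^ N * f z)

lemma qq_eq_qParam (z : ℂ) : qq z = Function.Periodic.qParam 1 z := by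
  simp [qq, Function.Periodic.qParam]

lemma norm_qq (z : ℂ) : ‖qq z‖ = Real.exp (-2 * Real.pi * z.im) := by
  rw [qq_eq_qParam, Function.Periodic.norm_qParam, div_one]

lemma norm_qq_lt_one (z : ℍ) : ‖qq z‖ < 1 := by
  rw [norm_qq, Real.exp_lt_one_iff]
  have := mul_pos Real.pi_pos z.im_pos
  have h : (z : ℂ).im = z.im := rfl
  rw [h]; linarith

lemma qq_ne_zero (z : ℂ) : qq z ≠ 0 := Complex.exp_ne_zero _

lemma qq_add (z w : ℂ) : qq (z + w) = qq z * qq w := by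
  rw [qq, qq, qq, ← Complex.exp_add]; ring_nf

lemma qq_natCast_mul (n : ℕ) (z : ℂ) : qq (n * z) = qq z ^ n := by
  rw [qq, qq, ← Complex.exp_nat_mul]; ring_nf

lemma qq_int (n : ℤ) : qq n = 1 := by
  rw [qq, Complex.exp_eq_one_iff]; exact ⟨n, by ring⟩

lemma tendsto_qq : Filter.Tendsto (fun z : ℍ => qq z) atImInfty (nhds 0) := by
  simpa only [qq_eq_qParam] using qParam_tendsto_atImInfty one_pos

namespace HasExp

variable {f g : ℍ → ℂ} {N M : ℕ} {c d : PowerSeries ℂ}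

lemma summable_norm (h : HasExp f N c) (z : ℍ) :
    Summable fun n => ‖PowerSeries.coeff n c * qq z ^ n‖ := (h z).summable.norm

lemma mul (hf : HasExp f N c) (hg : HasExp g M d) : HasExp (fun z => f z * g z) (N + M) (c * d) :=
    by
  intro z
  have h1 := hf.summable_norm z
  have h2 := hg.summable_norm z
  have h3 : ∀ n, PowerSeries.coeff n (c * d) * qq z ^ n =
      ∑ kl ∈ Finset.HasAntidiagonal.antidiagonal n, PowerSeries.coeff kl.1 c * qq z ^ kl.1 *
        (PowerSeries.coeff kl.2 d * qq z ^ kl.2) := by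
    intro n
    rw [PowerSeries.coeff_mul, Finset.sum_mul]
    refine Finset.sum_congr rfl fun kl hkl => ?_
    rw [← Finset.HasAntidiagonal.mem_antidiagonal.1 hkl, pow_add]; ring
  have h4 := tsum_mul_tsum_eq_tsum_sum_antidiagonal_of_summable_norm h1 h2
  rw [(hf z).tsum_eq, (hg z).tsum_eq] at h4
  simp only [h3]
  rw [show qq z ^ (N + M) * (f z * g z) = qq z ^ N * f z * (qq z ^ M * g z) by ring, h4]
  exact (summable_norm_sum_mul_antidiagonal_of_summable_norm h1 h2).of_norm.hasSum

lemma add (hf : HasExp f N c) (hg : HasExp g N d) : HasExp (fun z => f z + g z) N (c + d) := by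
  intro z
  simpa [add_mul, mul_add] using (hf z).add (hg z)

lemma sub (hf : HasExp f N c) (hg : HasExp g N d) : HasExp (fun z => f z - g z) N (c - d) := by
  intro z
  simpa [sub_mul, mul_sub] using (hf z).sub (hg z)

lemma const (a : ℂ) : HasExp (fun _ => a) 0 (PowerSeries.C a) := by
  intro z
  convert hasSum_single (f := fun n => PowerSeries.coeff n (PowerSeries.C a) *
      qq z ^ n) 0 ?_ using 1
  · simp
  · intro n hn; simp [PowerSeries.coeff_C, hn]

lemma shift (hf : HasExp f N c) (k : ℕ) : HasExp f (N + k) (PowerSeries.X ^ k * c) := by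
  intro z
  have h := (hf z).mul_left (qq z ^ k)
  rw [show qq z ^ (N + k) * f z = qq z ^ k * (qq z ^ N * f z) by ring]
  rw [← hasSum_nat_add_iff' k, Finset.sum_eq_zero, sub_zero]
  · refine h.congr_fun fun n => ?_
    rw [PowerSeries.coeff_X_pow_mul', if_pos (Nat.le_add_left k n), Nat.add_sub_cancel, pow_add]
    ring
  · intro n hn
    rw [PowerSeries.coeff_X_pow_mul', if_neg (by simpa using hn), zero_mul]

lemma unshift {k : ℕ} (hf : HasExp f (N + k) (PowerSeries.X ^ k * c)) : HasExp f N c := by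
  intro z
  have h := hf z
  rw [← hasSum_nat_add_iff' k, Finset.sum_eq_zero, sub_zero] at h
  · have h' := h.mul_left ((qq z ^ k)⁻¹)
    have hq := pow_ne_zero k (qq_ne_zero z)
    rw [show (qq z ^ k)⁻¹ * (qq z ^ (N + k) * f z) = qq z ^ N * f z by
      rw [pow_add]; field_simp] at h'
    refine h'.congr_fun fun n => ?_
    rw [PowerSeries.coeff_X_pow_mul', if_pos (Nat.le_add_left k n), Nat.add_sub_cancel, pow_add]
    field_simp
  · intro n hn
    rw [PowerSeries.coeff_X_pow_mul', if_neg (by simpa using hn), zero_mul]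

lemma pow (hf : HasExp f N c) (k : ℕ) : HasExp (fun z => f z ^ k) (k * N) (c ^ k) := by
  induction k with
  | zero => simpa using const 1
  | succ k ih => simpa only [pow_succ, Nat.succ_mul] using ih.mul hf

lemma sum {ι : Type*} (s : Finset ι) {F : ι → ℍ → ℂ} {C : ι → PowerSeries ℂ}
    (h : ∀ i ∈ s, HasExp (F i) N (C i)) : HasExp (fun z => ∑ i ∈ s, F i z) N (∑ i ∈ s, C i) := by
  intro z
  simpa [Finset.sum_mul, Finset.mul_sum] using hasSum_sum fun i hi => h i hi z

lemma tendsto (hf : HasExp f N c) :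
    Filter.Tendsto (fun z : ℍ => qq z ^ N * f z) atImInfty (nhds (PowerSeries.coeff 0 c)) := by
  have h1 : (fun z : ℍ => qq z ^ N * f z) = fun z : ℍ => ∑' n, PowerSeries.coeff n c * qq z ^ n :=
    funext fun z => (hf z).tsum_eq.symm
  have h2 : PowerSeries.coeff 0 c = ∑' n : ℕ, PowerSeries.coeff n c * 0 ^ n := by
    rw [tsum_eq_single 0 fun n hn => by simp [hn]]; simp
  rw [h1, h2]
  refine tendsto_tsum_of_dominated_convergence (hf.summable_norm I)
    (fun n => (tendsto_qq.pow n).const_mul _) ?_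
  have h3 : ∀ᶠ z : ℍ in atImInfty, 1 ≤ z.im :=
    (atImInfty_mem _).2 ⟨1, fun z hz => hz⟩
  filter_upwards [h3] with z hz n
  rw [norm_mul, norm_mul, norm_pow, norm_pow]
  gcongr
  rw [norm_qq, norm_qq, Real.exp_le_exp]
  have := mul_le_mul_of_nonneg_left hz Real.pi_pos.le
  have e1 : (z : ℂ).im = z.im := rfl
  have e2 : ((I : ℍ) : ℂ).im = 1 := by simp
  rw [e1, e2]; linarith

lemma eq_zero_of_fun_zero (hf : HasExp (fun _ => 0) N c) : c = 0 := by
  by_contra hc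
  have h1 := PowerSeries.X_pow_order_mul_divXPowOrder (f := c)
  have h0 : HasExp (fun _ => 0) (0 + c.order.toNat) (PowerSeries.X ^ c.order.toNat *
      c.divXPowOrder) := by
    rw [h1]; intro z; simpa using hf z
  have h2 := h0.unshift.tendsto
  simp only [mul_zero] at h2
  have h3 := tendsto_nhds_unique h2 tendsto_const_nhds
  rw [PowerSeries.coeff_zero_eq_constantCoeff] at h3
  exact hc (PowerSeries.constantCoeff_divXPowOrder_eq_zero_iff.1 h3)

lemma unique (hf : HasExp f N c) (hf' : HasExp f N d) : c = d := by
  have h := hf.sub hf'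
  simp only [sub_self] at h
  exact sub_eq_zero.1 h.eq_zero_of_fun_zero

lemma isBoundedAtImInfty (hf : HasExp f 0 c) : IsBoundedAtImInfty f := by
  refine isBoundedAtImInfty_of_hasSum_qExpansion (c := fun n => PowerSeries.coeff n c) one_pos ?_
  intro τ
  simpa [qq_eq_qParam] using hf τ

end HasExp

lemma periodic_comp_ofComplex {f : ℍ → ℂ} {h : ℝ} (hf : ∀ z : ℍ, f (h +ᵥ z) = f z) :
    Function.Periodic (f ∘ ofComplex) h := by
  intro w
  rcases le_or_gt w.im 0 with hw | hw
  · rw [Function.comp_apply, Function.comp_apply, ofComplex_apply_of_im_nonpos hw,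
      ofComplex_apply_of_im_nonpos (by simpa using hw)]
  · rw [Function.comp_apply, Function.comp_apply, ofComplex_apply_of_im_pos hw,
      ofComplex_apply_of_im_pos (by simpa using hw), ← hf ⟨w, hw⟩]
    congr 1
    ext1
    simp [add_comm]

lemma mdifferentiable_qq : MDifferentiable 𝓘(ℂ) 𝓘(ℂ) (fun z : ℍ => qq z) := by
  rw [mdifferentiable_iff]
  refine DifferentiableOn.congr (f := qq) ?_ fun z hz => ?_
  · unfold qq; fun_prop
  · simp [ofComplex_apply_of_im_pos hz]

lemma exists_hasExp {f : ℍ → ℂ} (hol : MDifferentiable 𝓘(ℂ) 𝓘(ℂ) f)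
    (hper : ∀ z : ℍ, f ((1 : ℝ) +ᵥ z) = f z) {N : ℕ}
    (hbdd : IsBoundedAtImInfty fun z : ℍ => qq z ^ N * f z) : ∃ c, HasExp f N c := by
  have hq : MDifferentiable 𝓘(ℂ) 𝓘(ℂ) (fun z : ℍ => qq z ^ N * f z) :=
    (mdifferentiable_qq.pow N).mul hol
  refine ⟨qExpansion 1 fun z : ℍ => qq z ^ N * f z, fun z => ?_⟩
  have h := hasSum_qExpansion one_pos (periodic_comp_ofComplex (h := 1) fun z => ?_) hq hbdd z
  · simpa [qq_eq_qParam] using h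
  · rw [hper]
    congr 2
    have h1 := qq_int 1
    rw [coe_vadd, add_comm, qq_add]
    push_cast at h1 ⊢
    rw [h1, mul_one]

namespace IsModularFun

variable {f g : ℍ → ℂ}

lemma const (a : ℂ) : IsModularFun fun _ => a where
  holo := mdifferentiable_const
  inv _ _ _ := rfl
  bdd _ _ := Filter.const_boundedAtFilter _ a

lemma mul (hf : IsModularFun f) (hg : IsModularFun g) : IsModularFun fun z => f z * g z where
  holo := hf.holo.mul hg.holo
  inv γ h z := by rw [hf.inv γ h, hg.inv γ h]
  bdd γ h := (hf.bdd γ h).mul (hg.bdd γ h)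

lemma add (hf : IsModularFun f) (hg : IsModularFun g) : IsModularFun fun z => f z + g z where
  holo := hf.holo.add hg.holo
  inv γ h z := by rw [hf.inv γ h, hg.inv γ h]
  bdd γ h := (hf.bdd γ h).add (hg.bdd γ h)

lemma pow (hf : IsModularFun f) (k : ℕ) : IsModularFun fun z => f z ^ k := by
  induction k with
  | zero => simpa using const 1
  | succ k ih => simpa only [pow_succ] using ih.mul hf

lemma sub (hf : IsModularFun f) (hg : IsModularFun g) : IsModularFun fun z => f z - g z := by
  simpa [sub_eq_add_neg] using hf.add ((const (-1)).mul hg)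

lemma sum {ι : Type*} (s : Finset ι) {F : ι → ℍ → ℂ} (h : ∀ i ∈ s, IsModularFun (F i)) :
    IsModularFun fun z => ∑ i ∈ s, F i z := by
  classical
  induction s using Finset.induction_on with
  | empty => simpa using const 0
  | insert i s hi ih =>
    simp only [Finset.sum_insert hi]
    exact (h i (by simp)).add (ih fun j hj => h j (by simp [hj]))

lemma periodic (hf : IsModularFun f) (z : ℍ) : f ((1 : ℝ) +ᵥ z) = f z := by
  have h := hf.inv ModularGroup.T (by simp [ModularGroup.T]) z
  rwa [modular_T_smul] at h

lemma eq_const_of_isBoundedAtImInfty (hf : IsModularFun f) (hb : IsBoundedAtImInfty f) :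
    ∃ a, ∀ z, f z = a := by
  have hbdd : ∀ γ : SL(2, ℤ), IsBoundedAtImInfty (f ∣[(0 : ℤ)] γ) := by
    intro γ
    have h1 : f ∣[(0 : ℤ)] γ = fun z => f (γ • z) := by
      funext z; rw [SL_slash_apply]; simp
    rw [h1]
    by_cases h : (25 : ℤ) ∣ γ 1 0
    · simpa only [hf.inv γ h] using hb
    · exact hf.bdd γ h
  let F : ModularForm ((CongruenceSubgroup.Gamma0 25).map (Matrix.SpecialLinearGroup.mapGL ℝ)) 0 :=
    { toFun := f
      slash_action_eq' := by
        rintro _ ⟨γ, hγ, rfl⟩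
        have h1 : f ∣[(0 : ℤ)] γ = f := by
          funext z
          rw [SL_slash_apply]
          simp only [neg_zero, zpow_zero, mul_one]
          refine hf.inv γ ?_ z
          have h2 : ((γ 1 0 : ℤ) : ZMod 25) = 0 := CongruenceSubgroup.Gamma0_mem.1 hγ
          exact_mod_cast (ZMod.intCast_zmod_eq_zero_iff_dvd _ 25).1 h2
        exact h1
      holo' := hf.holo
      bdd_at_cusps' := by
        intro c hc
        rw [Subgroup.IsArithmetic.isCusp_iff_isCusp_SL2Z] at hc
        rw [OnePoint.isBoundedAt_iff_forall_SL2Z hc]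
        exact fun γ _ => hbdd γ }
  obtain ⟨a, ha⟩ := ModularForm.eq_const_of_weight_zero F
  exact ⟨a, fun z => congrFun ha z⟩

lemma eq_zero_of_hasExp (hf : IsModularFun f) {N : ℕ} {c : PowerSeries ℂ}
    (hc : HasExp f N (PowerSeries.X ^ (N + 1) * c)) : (∀ z, f z = 0) ∧ c = 0 := by
  have h1 : HasExp f 0 (PowerSeries.X * c) := by
    apply HasExp.unshift (k := N)
    rw [zero_add]; convert hc using 1; ring
  obtain ⟨a, ha⟩ := hf.eq_const_of_isBoundedAtImInfty h1.isBoundedAtImInfty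
  have h2 := h1.tendsto
  simp only [ha, pow_zero, one_mul] at h2
  have h3 : a = 0 := by
    simpa using tendsto_nhds_unique tendsto_const_nhds h2
  subst h3
  refine ⟨ha, ?_⟩
  have h4 : f = fun _ => 0 := funext ha
  rw [h4] at hc
  exact (mul_eq_zero.1 hc.eq_zero_of_fun_zero).resolve_left (pow_ne_zero _ PowerSeries.X_ne_zero)

end IsModularFun

/-- Every power series agrees up to order `N` with a combination of `X ^ (N - k) * u ^ k`. -/
lemma exists_triangular {R : Type*} [CommRing R] {u : PowerSeries R}
    (hu : PowerSeries.constantCoeff u = 1) (N : ℕ) (g : PowerSeries R) :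
    ∃ r : ℕ → R, r N = PowerSeries.constantCoeff g ∧ PowerSeries.X ^ (N + 1) ∣
      g - ∑ k ∈ Finset.range (N + 1), PowerSeries.C (r k) * (PowerSeries.X ^ (N - k) * u ^ k) := by
  induction N generalizing g with
  | zero =>
    refine ⟨fun _ => PowerSeries.constantCoeff g, rfl, ?_⟩
    rw [zero_add, pow_one, PowerSeries.X_dvd_iff]; simp
  | succ N ih =>
    have h1 : PowerSeries.X ∣ g - PowerSeries.C (PowerSeries.constantCoeff g) * u ^ (N + 1) := by
      rw [PowerSeries.X_dvd_iff]; simp [hu]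
    obtain ⟨g', hg'⟩ := h1
    obtain ⟨r, -, hr⟩ := ih g'
    refine ⟨fun k => if k = N + 1 then PowerSeries.constantCoeff g else r k, by simp, ?_⟩
    dsimp only
    rw [Finset.sum_range_succ, if_pos rfl, Nat.sub_self, pow_zero, one_mul]
    have h2 : ∑ k ∈ Finset.range (N + 1), PowerSeries.C (if k =
        N + 1 then PowerSeries.constantCoeff g
        else r k) * (PowerSeries.X ^ (N + 1 - k) * u ^ k) = PowerSeries.X *
        ∑ k ∈ Finset.range (N + 1), PowerSeries.C (r k) * (PowerSeries.X ^ (N - k) * u ^ k) := by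
      rw [Finset.mul_sum]
      refine Finset.sum_congr rfl fun k hk => ?_
      have hk' := Finset.mem_range.1 hk
      rw [if_neg (by omega), Nat.sub_add_comm (by omega), pow_succ]; ring
    rw [h2, sub_add_eq_sub_sub_swap, hg', ← mul_sub, pow_succ']
    exact mul_dvd_mul_left _ hr

/-- A modular function whose expansion at `∞` is `map φ g` is a polynomial, with coefficients in the
image of `φ`, in a modular function with a simple pole. -/
lemma IsModularFun.exists_eq_sum_pow {R : Type*} [CommRing R] (φ : R →+* ℂ) {f s : ℍ → ℂ}
    (hf : IsModularFun f) (hs : IsModularFun s) {u g : PowerSeries R} {N : ℕ}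
    (hu : PowerSeries.constantCoeff u = 1) (hsu : HasExp s 1 (PowerSeries.map φ u))
    (hfg : HasExp f N (PowerSeries.map φ g)) :
    ∃ r : ℕ → R, r N = PowerSeries.constantCoeff g ∧
      (∀ z, f z = ∑ k ∈ Finset.range (N + 1), φ (r k) * s z ^ k) ∧
      PowerSeries.map φ g = PowerSeries.map φ
        (∑ k ∈ Finset.range (N + 1), PowerSeries.C (r k) * (PowerSeries.X ^ (N - k) * u ^ k)) := by
  obtain ⟨r, hr, c, hc⟩ := exists_triangular hu N g
  have h1 : IsModularFun fun z => ∑ k ∈ Finset.range (N + 1), φ (r k) * s z ^ k :=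
    IsModularFun.sum _ fun k _ => (IsModularFun.const _).mul (hs.pow k)
  have h2 : HasExp (fun z => ∑ k ∈ Finset.range (N + 1), φ (r k) * s z ^ k) N (PowerSeries.map φ
      (∑ k ∈ Finset.range (N + 1), PowerSeries.C (r k) * (PowerSeries.X ^ (N - k) * u ^ k))) := by
    rw [map_sum]
    refine HasExp.sum _ fun k hk => ?_
    have hk' : k ≤ N := Nat.lt_succ_iff.1 (Finset.mem_range.1 hk)
    have h3 := (HasExp.const (φ (r k))).mul ((hsu.pow k).shift (N - k))
    rw [mul_one, Nat.add_sub_cancel' hk', zero_add] at h3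
    simpa using h3
  have h4 := hfg.sub h2
  rw [← map_sub, hc, map_mul, map_pow, PowerSeries.map_X] at h4
  obtain ⟨h5, h6⟩ := (hf.sub h1).eq_zero_of_hasExp h4
  refine ⟨r, hr, fun z => sub_eq_zero.1 (h5 z), ?_⟩
  rw [← sub_eq_zero, ← map_sub, hc, map_mul, h6, mul_zero]

end GammaZero

namespace GammaZero

/-- The integral power series `q ^ m * f`, where `f = q ^ (-m) + ∑ a n * q ^ n`. -/
noncomputable def canonicalSeries (m : ℕ) (a : ℕ → ℤ) : PowerSeries ℤ :=
  PowerSeries.mk fun k => if k = 0 then 1 else if k ≤ m then 0 else a (k - m)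

lemma isModularFun_of_isCanonicalBasis {m : ℕ} {f : ℍ → ℂ} {a : ℕ → ℤ}
    (h : IsCanonicalBasis0 25 m f a) : IsModularFun f := by
  obtain ⟨⟨h1, h2, -, h4⟩, -⟩ := h
  have e : ∀ γ : SL(2, ℤ), f ∣[(0 : ℤ)] γ = fun z => f (γ • z) := by
    intro γ; funext z; rw [SL_slash_apply]; simp
  refine ⟨h1, fun γ hγ z => ?_, fun γ hγ => ?_⟩
  · have h5 := h2 γ (CongruenceSubgroup.Gamma0_mem.2
      ((ZMod.intCast_zmod_eq_zero_iff_dvd _ 25).2 (by exact_mod_cast hγ)))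
    rw [e] at h5
    exact congrFun h5 z
  · rw [← e]; exact h4 γ (by exact_mod_cast hγ)

lemma hasSum_canonicalSeries {m : ℕ} {a : ℕ → ℤ} {w : ℂ} (hw : w ≠ 0)
    (hs : Summable fun n : ℕ => (a (n + 1) : ℂ) * w ^ (n + 1)) :
    HasSum (fun n => PowerSeries.coeff n (PowerSeries.map (Int.castRingHom ℂ)
        (canonicalSeries m a)) *
      w ^ n) (w ^ m * (w ^ (-(m : ℤ)) + ∑' n : ℕ, (a (n + 1) : ℂ) * w ^ (n + 1))) := by
  rw [← hasSum_nat_add_iff' (m + 1), Finset.sum_eq_single 0]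
  · have h1 : w ^ m * (w ^ (-(m : ℤ)) + ∑' n : ℕ, (a (n + 1) : ℂ) * w ^ (n + 1)) -
        PowerSeries.coeff 0 (PowerSeries.map (Int.castRingHom ℂ) (canonicalSeries m a)) * w ^ 0 =
        w ^ m * ∑' n : ℕ, (a (n + 1) : ℂ) * w ^ (n + 1) := by
      rw [mul_add, _root_.zpow_neg, zpow_natCast, mul_inv_cancel₀ (pow_ne_zero m hw)]
      simp [canonicalSeries]
    rw [h1]
    refine (hs.hasSum.mul_left (w ^ m)).congr_fun fun n => ?_
    rw [PowerSeries.coeff_map, canonicalSeries, PowerSeries.coeff_mk, if_neg (by omega),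
      if_neg (by omega), show n + (m + 1) - m = n + 1 by omega]
    simp only [eq_intCast]
    ring
  · intro n hn hn0
    rw [PowerSeries.coeff_map, canonicalSeries, PowerSeries.coeff_mk, if_neg hn0,
      if_pos (Nat.lt_succ_iff.1 (Finset.mem_range.1 hn))]
    simp
  · simp

lemma exists_summable_of_isCanonicalBasis {m : ℕ} (hm : 1 ≤ m) {f : ℍ → ℂ} {a : ℕ → ℤ}
    (h : IsCanonicalBasis0 25 m f a) :
    ∃ z : ℍ, Summable fun n : ℕ => (a (n + 1) : ℂ) * qq z ^ (n + 1) := by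
  by_contra! hn
  have h1 : ∀ z : ℍ, f z = qq z ^ (-(m : ℤ)) := fun z => by
    rw [h.2 z, tsum_eq_zero_of_not_summable (hn z), add_zero]
  let γ : SL(2, ℤ) := ⟨!![1, 0; 25, 1], by simp [Matrix.det_fin_two]⟩
  have h2 := (isModularFun_of_isCanonicalBasis h).inv γ (by simp [γ]) UpperHalfPlane.I
  rw [h1, h1] at h2
  have h3 := congrArg (fun w : ℂ => ‖w‖) h2
  simp only [_root_.zpow_neg, zpow_natCast, norm_inv, norm_pow, _root_.inv_inj] at h3
  rw [pow_left_inj₀ (norm_nonneg _) (norm_nonneg _) (by omega), norm_qq, norm_qq,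
    Real.exp_eq_exp] at h3
  have h4 : (γ • UpperHalfPlane.I).im = UpperHalfPlane.I.im := by
    have := Real.pi_pos
    have h5 := mul_left_cancel₀ (by linarith : -2 * Real.pi ≠ 0) h3
    exact h5
  rw [ModularGroup.im_smul_eq_div_normSq, UpperHalfPlane.I_im, ModularGroup.denom_apply] at h4
  simp [γ, Complex.normSq_apply] at h4

lemma hasExp_of_isCanonicalBasis {m : ℕ} (hm : 1 ≤ m) {f : ℍ → ℂ} {a : ℕ → ℤ}
    (h : IsCanonicalBasis0 25 m f a) :
    HasExp f m (PowerSeries.map (Int.castRingHom ℂ) (canonicalSeries m a)) := by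
  have hf := isModularFun_of_isCanonicalBasis h
  obtain ⟨M, hM⟩ := h.1.2.2.1 1
  rw [SlashAction.slash_one] at hM
  obtain ⟨c, hc⟩ := exists_hasExp hf.holo hf.periodic hM
  obtain ⟨z₀, hz₀⟩ := exists_summable_of_isCanonicalBasis hm h
  set b := PowerSeries.map (Int.castRingHom ℂ) (canonicalSeries m a) with hb
  have hlift : ∀ z : ℍ, ∃ z' : ℍ, qq z' = qq z₀ * qq z := fun z =>
    ⟨⟨z₀ + z, by simpa using add_pos z₀.im_pos z.im_pos⟩, qq_add _ _⟩
  choose t ht using hlift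
  have h1 : HasExp (fun z => f (t z) * qq (t z) ^ (m + M)) 0
      (PowerSeries.rescale (qq z₀) (PowerSeries.X ^ m * c)) := by
    intro z
    have h2 := hc.shift m (t z)
    rw [add_comm M m] at h2
    rw [pow_zero, one_mul]
    dsimp only
    rw [mul_comm (f (t z))]
    refine h2.congr_fun fun n => ?_
    rw [PowerSeries.coeff_rescale, ht, mul_pow]; ring
  have h3 : HasExp (fun z => f (t z) * qq (t z) ^ (m + M)) 0
      (PowerSeries.rescale (qq z₀) (PowerSeries.X ^ M * b)) := by
    intro z
    have hs : Summable fun n : ℕ => (a (n + 1) : ℂ) * qq (t z) ^ (n + 1) := by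
      refine Summable.of_norm_bounded hz₀.norm fun n => ?_
      rw [ht, mul_pow, ← mul_assoc, norm_mul _ (qq z ^ (n + 1)), norm_pow _ (n + 1)]
      exact mul_le_of_le_one_right (norm_nonneg _)
        (pow_le_one₀ (norm_nonneg _) (norm_qq_lt_one z).le)
    have h4 := hasSum_canonicalSeries (m := m) (qq_ne_zero (t z)) hs
    rw [← h.2 (t z), ← hb] at h4
    have h5 : HasSum (fun n => PowerSeries.coeff n (PowerSeries.X ^ M * b) * qq (t z) ^ n)
        (qq (t z) ^ M * (qq (t z) ^ m * f (t z))) := by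
      rw [← hasSum_nat_add_iff' M, Finset.sum_eq_zero, sub_zero]
      · refine (h4.mul_left _).congr_fun fun n => ?_
        rw [PowerSeries.coeff_X_pow_mul', if_pos (Nat.le_add_left M n), Nat.add_sub_cancel, pow_add]
        ring
      · intro n hn
        rw [PowerSeries.coeff_X_pow_mul', if_neg (by simpa using hn), zero_mul]
    rw [show qq z ^ 0 * (f (t z) * qq (t z) ^ (m + M)) =
      qq (t z) ^ M * (qq (t z) ^ m * f (t z)) by ring]
    refine h5.congr_fun fun n => ?_
    rw [PowerSeries.coeff_rescale, ht, mul_pow]; ring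
  have h5 := PowerSeries.rescale_injective (qq_ne_zero z₀) (h1.unique h3)
  have h6 := hc.shift m
  rw [h5, add_comm] at h6
  exact h6.unshift

end GammaZero

namespace GammaZero

section Euler

variable {x : ℂ}

lemma norm_prod_one_sub_pow_le (hx : ‖x‖ < 1) (k n : ℕ) :
    ‖∏ i ∈ Finset.range n, (1 - x ^ (k + i + 1))‖ ≤ Real.exp (1 - ‖x‖)⁻¹ := by
  have h0 := norm_nonneg x
  rw [norm_prod]
  calc ∏ i ∈ Finset.range n, ‖1 - x ^ (k + i + 1)‖
      ≤ ∏ i ∈ Finset.range n, Real.exp (‖x‖ ^ i) := by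
        refine Finset.prod_le_prod (fun _ _ => norm_nonneg _) fun i _ => ?_
        calc ‖1 - x ^ (k + i + 1)‖ ≤ ‖(1 : ℂ)‖ + ‖x ^ (k + i + 1)‖ := norm_sub_le _ _
          _ ≤ ‖x‖ ^ i + 1 := by
            rw [norm_one, norm_pow, add_comm]
            gcongr 1
            exact pow_le_pow_of_le_one h0 hx.le (by omega)
          _ ≤ Real.exp (‖x‖ ^ i) := Real.add_one_le_exp _
    _ = Real.exp (∑ i ∈ Finset.range n, ‖x‖ ^ i) := (Real.exp_sum _ _).symm
    _ ≤ Real.exp (1 - ‖x‖)⁻¹ := by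
        rw [Real.exp_le_exp, ← tsum_geometric_of_lt_one h0 hx]
        exact (summable_geometric_of_lt_one h0 hx).sum_le_tsum _ fun i _ => by positivity

lemma norm_pow_mul_prod_le (hx : ‖x‖ < 1) (k n : ℕ) :
    ‖x ^ ((k + 1) * n) * ∏ i ∈ Finset.range (n + 1), (1 - x ^ (k + i + 1))‖ ≤
      ‖x‖ ^ n * Real.exp (1 - ‖x‖)⁻¹ := by
  rw [norm_mul, norm_pow]
  refine mul_le_mul ?_ (norm_prod_one_sub_pow_le hx k (n + 1)) (norm_nonneg _) (by positivity)
  exact pow_le_pow_of_le_one (norm_nonneg _) hx.le (Nat.le_mul_of_pos_left n (by omega))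

lemma hasSum_pentagonalSeries (hx : ‖x‖ < 1) :
    HasSum (fun n => PowerSeries.coeff n (PowerSeries.map (Int.castRingHom ℂ)
      (PowerSeries.pentagonalSeries ℤ)) * x ^ n) (∏' n : ℕ, (1 - x ^ (n + 1))) := by
  have h0 := norm_nonneg x
  have hsumZ : Summable fun k : ℤ => ((Int.negOnePow k : ℤ) : ℂ) * x ^ pentagonal k := by
    refine Summable.of_norm_bounded
      ((summable_geometric_of_lt_one h0 hx).comp_injective pentagonal_injective) fun k => ?_
    rw [norm_mul, norm_pow]
    rcases Int.units_eq_one_or (Int.negOnePow k) with h | h <;> simp [h]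
  have hnat := hsumZ.hasSum
  rw [← neg_injective.hasSum_iff (fun x hx ↦ by absurd hx; use -x; simp)] at hnat
  have hnat' : HasSum (fun k : ℕ ↦ (-1 : ℂ) ^ k * (x ^ pentagonal (-k) - x ^ pentagonal (k + 1)))
      (∑' k : ℤ, ((Int.negOnePow k : ℤ) : ℂ) * x ^ pentagonal k) := by
    convert hnat.nat_add_neg_add_one using 2 with k
    simp_rw [Function.comp_apply, neg_neg, Int.negOnePow_add]
    simp
    ring
  have hgeom : ∀ k, Summable fun n =>
      x ^ ((k + 1) * n) * ∏ i ∈ Finset.range (n + 1), (1 - x ^ (k + i + 1)) := fun k =>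
    Summable.of_norm_bounded ((summable_geometric_of_lt_one h0 hx).mul_right _)
      (norm_pow_mul_prod_le hx k)
  have hprod := Pentagonal.tprod_one_sub_pow (tendsto_pow_atTop_nhds_zero_of_norm_lt_one hx) hgeom
    (fun k => by
      apply multipliable_one_add_of_summable (f := fun n ↦ -x ^ (n + k + 1))
      simpa [add_assoc] using (summable_nat_add_iff (k + 1)).mpr
        (summable_geometric_of_lt_one h0 hx))
    hnat'.summable (by
      have h1 : Filter.Tendsto (fun k : ℕ => ‖x‖ ^ k * ((1 - ‖x‖)⁻¹ * Real.exp (1 - ‖x‖)⁻¹))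
          Filter.atTop (nhds 0) := by
        simpa using (tendsto_pow_atTop_nhds_zero_of_lt_one h0 hx).mul_const
          ((1 - ‖x‖)⁻¹ * Real.exp (1 - ‖x‖)⁻¹)
      refine squeeze_zero_norm (fun k => ?_) h1
      rw [norm_mul, norm_mul, norm_pow, norm_pow, norm_neg, norm_one, one_pow, one_mul]
      refine mul_le_mul (pow_le_pow_of_le_one h0 hx.le ?_) ?_ (norm_nonneg _) (by positivity)
      · rw [Nat.le_div_iff_mul_le two_pos]; nlinarith
      · exact tsum_of_norm_bounded ((hasSum_geometric_of_lt_one h0 hx).mul_right _)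
          (norm_pow_mul_prod_le hx k))
  rw [hprod, hnat'.tsum_eq]
  rw [← pentagonal_injective.hasSum_iff fun n hn => by
    rw [PowerSeries.coeff_map, PowerSeries.coeff_pentagonalSeries_eq_zero _ hn]; simp]
  refine hsumZ.hasSum.congr_fun fun k => ?_
  rw [Function.comp_apply, PowerSeries.coeff_map, PowerSeries.coeff_pentagonalSeries_pentagonal]
  simp

end Euler

/-- The Euler product `∏ (1 - q ^ n)` in the variable `q ^ d`. -/
noncomputable def eulerProd (d : ℕ) (z : ℍ) : ℂ := ∏' n : ℕ, (1 - (qq z ^ d) ^ (n + 1))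

lemma hasExp_eulerProd {d : ℕ} (hd : d ≠ 0) : HasExp (eulerProd d) 0 (PowerSeries.map
    (Int.castRingHom ℂ) (PowerSeries.expand d hd (PowerSeries.pentagonalSeries ℤ))) := by
  intro z
  have hx : ‖qq z ^ d‖ < 1 := by
    rw [norm_pow]; exact pow_lt_one₀ (norm_nonneg _) (norm_qq_lt_one z) hd
  have h := hasSum_pentagonalSeries hx
  rw [pow_zero, one_mul]
  have hinj : Function.Injective fun n : ℕ => d * n := fun a b hab =>
    Nat.eq_of_mul_eq_mul_left (Nat.pos_of_ne_zero hd) hab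
  rw [← hinj.hasSum_iff fun n hn => by
    rw [PowerSeries.coeff_map, PowerSeries.coeff_expand_of_not_dvd]
    · simp
    · rintro ⟨k, rfl⟩; exact hn ⟨k, rfl⟩]
  refine h.congr_fun fun n => ?_
  rw [Function.comp_apply, PowerSeries.coeff_map, PowerSeries.coeff_map,
    PowerSeries.coeff_expand_mul, pow_mul]

end GammaZero

namespace GammaZero

/-- The dilation `z ↦ N * z` of the upper half plane. -/
noncomputable def dilation (N : ℕ) (hN : 0 < N) (z : ℍ) : ℍ :=
  ⟨(N : ℝ) * z, by
    rw [Complex.im_ofReal_mul]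
    exact mul_pos (Nat.cast_pos.2 hN) z.im_pos⟩

lemma coe_dilation (N : ℕ) (hN : 0 < N) (z : ℍ) : (dilation N hN z : ℂ) = N * z := by
  simp [dilation]

lemma mdifferentiable_dilation {f : ℍ → ℂ} (hf : MDifferentiable 𝓘(ℂ) 𝓘(ℂ) f) (N : ℕ) (hN : 0 < N) :
    MDifferentiable 𝓘(ℂ) 𝓘(ℂ) fun z => f (dilation N hN z) := by
  rw [mdifferentiable_iff] at hf ⊢
  have h1 : DifferentiableOn ℂ (fun z : ℂ => (f ∘ ofComplex) (N * z)) {z | 0 < z.im} := by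
    refine DifferentiableOn.comp (g := f ∘ ofComplex) (f := fun z => (N : ℂ) * z)
      (t := {z | 0 < z.im}) hf (by fun_prop) fun z hz => ?_
    have := mul_pos (Nat.cast_pos.2 hN : (0 : ℝ) < N) hz
    simpa using this
  refine h1.congr fun z hz => ?_
  have h2 : 0 < ((N : ℂ) * z).im := by
    have := mul_pos (Nat.cast_pos.2 hN : (0 : ℝ) < N) hz
    simpa using this
  rw [Function.comp_apply, Function.comp_apply, ofComplex_apply_of_im_pos h2,
    ofComplex_apply_of_im_pos hz]
  congr 1

lemma discriminant_eq (z : ℍ) : discriminant z = qq z * (∏' n : ℕ, (1 - qq z ^ (n + 1))) ^ 24 := by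
  rw [discriminant_eq_q_prod, qq_eq_qParam, (multipliable_one_sub_pow ?_).tprod_pow]
  simpa [← qq_eq_qParam] using norm_qq_lt_one z

/-- The function `z ↦ Δ (N * z)`. -/
noncomputable def delta (N : ℕ) (hN : 0 < N) (z : ℍ) : ℂ := discriminant (dilation N hN z)

variable {N : ℕ} {hN : 0 < N}

lemma delta_ne_zero (z : ℍ) : delta N hN z ≠ 0 := discriminant_ne_zero _

lemma mdifferentiable_delta : MDifferentiable 𝓘(ℂ) 𝓘(ℂ) (delta N hN) :=
  mdifferentiable_dilation CuspForm.discriminant.holo' N hN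

lemma hasExp_delta : HasExp (delta N hN) 0 (PowerSeries.X ^ N * PowerSeries.map (Int.castRingHom ℂ)
    (PowerSeries.expand N hN.ne' (PowerSeries.pentagonalSeries ℤ)) ^ 24) := by
  have h1 := ((hasExp_eulerProd hN.ne').pow 24).shift N
  rw [mul_zero] at h1
  intro z
  have h2 := h1 z
  rw [pow_zero, one_mul, delta, discriminant_eq, coe_dilation, qq_natCast_mul]
  rwa [zero_add] at h2

lemma cocycle_ne_zero (γ : SL(2, ℤ)) (z : ℍ) : (γ 1 0 : ℂ) * z + γ 1 1 ≠ 0 := by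
  rw [← ModularGroup.denom_apply]; exact denom_ne_zero _ _

lemma discriminant_smul (γ : SL(2, ℤ)) (z : ℍ) :
    discriminant (γ • z) = ((γ 1 0 : ℂ) * z + γ 1 1) ^ 12 * discriminant z := by
  have h : (discriminant ∣[(12 : ℤ)] γ) = discriminant :=
    SlashInvariantForm.slash_action_generators_SL2Z discriminant_S_invariant
      discriminant_T_invariant γ
  have h1 := congrFun h z
  rw [SL_slash_apply, ModularGroup.denom_apply] at h1
  have h2 := cocycle_ne_zero γ z
  have h3 : ((γ 1 0 : ℂ) * z + γ 1 1) ^ (-(12 : ℤ)) = (((γ 1 0 : ℂ) * z + γ 1 1) ^ 12)⁻¹ := by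
    rw [_root_.zpow_neg]; norm_cast
  rw [h3] at h1
  rw [← h1]
  field_simp

lemma coe_smul (γ : SL(2, ℤ)) (z : ℍ) :
    ((γ • z : ℍ) : ℂ) = (γ 0 0 * z + γ 0 1) / (γ 1 0 * z + γ 1 1) := by
  rw [UpperHalfPlane.specialLinearGroup_apply]; simp

lemma det_eq (γ : SL(2, ℤ)) : γ 0 0 * γ 1 1 - γ 0 1 * γ 1 0 = 1 := by
  rw [← Matrix.det_fin_two, γ.2]

/-- The transformation of `Δ (N * z)` under `γ`, where `γ` is conjugated by a
matrix `[[g, B], [0, N']]` into `γ'`. -/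
lemma delta_smul_aux {γ γ' : SL(2, ℤ)} {g N' B : ℤ} (hN' : 0 < N')
    (h00 : γ' 0 0 * g = N * γ 0 0) (h01 : γ' 0 0 * B + γ' 0 1 * N' = N * γ 0 1)
    (h10 : γ' 1 0 * g = γ 1 0) (h11 : γ' 1 0 * B + γ' 1 1 * N' = γ 1 1) (z w : ℍ)
    (hw : (w : ℂ) * N' = g * z + B) :
    delta N hN (γ • z) = ((N' : ℂ) ^ 12)⁻¹ * (γ 1 0 * z + γ 1 1) ^ 12 * discriminant w := by
  have hN0 : (N' : ℂ) ≠ 0 := by exact_mod_cast hN'.ne'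
  have c00 : (γ' 0 0 : ℂ) * g = N * γ 0 0 := by exact_mod_cast h00
  have c01 : (γ' 0 0 : ℂ) * B + γ' 0 1 * N' = N * γ 0 1 := by exact_mod_cast h01
  have c10 : (γ' 1 0 : ℂ) * g = γ 1 0 := by exact_mod_cast h10
  have c11 : (γ' 1 0 : ℂ) * B + γ' 1 1 * N' = γ 1 1 := by exact_mod_cast h11
  have e1 : ((γ' 0 0 : ℂ) * w + γ' 0 1) * N' = N * (γ 0 0 * z + γ 0 1) := by
    linear_combination (γ' 0 0 : ℂ) * hw + z * c00 + c01
  have e2 : ((γ' 1 0 : ℂ) * w + γ' 1 1) * N' = γ 1 0 * z + γ 1 1 := by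
    linear_combination (γ' 1 0 : ℂ) * hw + z * c10 + c11
  have h1 : dilation N hN (γ • z) = γ' • w := by
    ext1
    rw [coe_dilation, coe_smul, coe_smul, mul_div_assoc', div_eq_div_iff (cocycle_ne_zero γ z)
      (cocycle_ne_zero γ' w), ← e1, ← e2]
    ring
  rw [delta, h1, discriminant_smul, ← e2]
  field_simp

lemma delta_smul_of_dvd {γ : SL(2, ℤ)} (h : (N : ℤ) ∣ γ 1 0) (z : ℍ) :
    delta N hN (γ • z) = (γ 1 0 * z + γ 1 1) ^ 12 * delta N hN z := by
  obtain ⟨c, hc⟩ := h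
  have hd := det_eq γ
  let γ' : SL(2, ℤ) := ⟨!![γ 0 0, N * γ 0 1; c, γ 1 1], by
    rw [Matrix.det_fin_two_of]; rw [hc] at hd; linear_combination hd⟩
  rw [delta_smul_aux (γ := γ) (γ' := γ') (g := N) (N' := 1) (B := 0) one_pos
    (by simp [γ', mul_comm]) (by simp [γ']) (by simp [γ', hc, mul_comm]) (by simp [γ']) z
    (dilation N hN z) (by rw [coe_dilation]; simp)]
  simp [delta]

lemma exists_delta_smul_eq (γ : SL(2, ℤ)) (g N' c' : ℤ) (hg : 0 < g) (hN' : 0 < N')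
    (hgN : g * N' = N) (hgc : g * c' = γ 1 0) (hco : IsCoprime N' c') :
    ∃ κ : ℂ, κ ≠ 0 ∧ ∀ z : ℍ, ∃ w : ℍ, w.im * N' = g * z.im ∧
      delta N hN (γ • z) = κ * (γ 1 0 * z + γ 1 1) ^ 12 * discriminant w := by
  have hd := det_eq γ
  have hac : IsCoprime (γ 0 0) c' := ⟨γ 1 1, -(γ 0 1 * g),
      by rw [← hgc] at hd; linear_combination hd⟩
  obtain ⟨u, v, huv⟩ := IsCoprime.mul_left hco hac
  let γ' : SL(2, ℤ) := ⟨!![N' * γ 0 0, -v; c', u], by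
    rw [Matrix.det_fin_two_of]; linear_combination huv⟩
  have hN0 : (N' : ℝ) ≠ 0 := by exact_mod_cast hN'.ne'
  set B : ℤ := u * N * γ 0 1 + v * γ 1 1 with hB
  refine ⟨((N' : ℂ) ^ 12)⁻¹, by simpa using hN'.ne', fun z => ?_⟩
  have him : 0 < (((g / N' : ℝ) : ℂ) * z + (B / N' : ℝ)).im := by
    have h1 : 0 < (g / N' : ℝ) := div_pos (by exact_mod_cast hg) (by exact_mod_cast hN')
    rw [Complex.add_im, Complex.im_ofReal_mul, Complex.ofReal_im, add_zero]
    exact mul_pos h1 z.im_pos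
  refine ⟨⟨_, him⟩, ?_, ?_⟩
  · change (((g / N' : ℝ) : ℂ) * z + (B / N' : ℝ)).im * N' = _
    rw [Complex.add_im, Complex.im_ofReal_mul, Complex.ofReal_im, add_zero]
    change (g / N' : ℝ) * z.im * N' = _
    field_simp
  · refine delta_smul_aux (γ' := γ') (g := g) (B := B) hN' ?_ ?_ ?_ ?_ z _ ?_
    · simp only [γ', Matrix.of_apply, Matrix.cons_val', Matrix.cons_val_zero]
      linear_combination γ 0 0 * hgN
    · simp [γ']
      rw [hB]
      linear_combination (N * γ 0 1) * huv + v * N' * hd - v * N' * γ 0 1 * hgc + v * c' * γ 0 1 *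
          hgN
    · simp [γ']; linear_combination hgc
    · simp [γ']
      rw [hB]
      linear_combination γ 1 1 * huv - N' * u * hd + N' * u * γ 0 1 * hgc - u * γ 0 1 * c' * hgN
    · change (((g / N' : ℝ) : ℂ) * z + (B / N' : ℝ)) * N' = _
      have hN0' : (N' : ℂ) ≠ 0 := by exact_mod_cast hN'.ne'
      push_cast
      field_simp

lemma eventually_norm_discriminant : ∃ Y : ℝ, ∀ w : ℍ, Y ≤ w.im →
    Real.exp (-2 * Real.pi * w.im) / 2 ≤ ‖discriminant w‖ ∧
      ‖discriminant w‖ ≤ 2 * Real.exp (-2 * Real.pi * w.im) := by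
  have h1 := tendsto_atImInfty_tprod_one_sub_eta_q_pow.norm.eventually
    (Ioo_mem_nhds (a := 1 / 2) (b := 2) (by simp; norm_num) (by simp))
  obtain ⟨Y, hY⟩ := (atImInfty_mem _).1 h1
  refine ⟨Y, fun w hw => ?_⟩
  obtain ⟨h2, h3⟩ := hY w hw
  rw [discriminant_eq_q_prod, norm_mul, ← qq_eq_qParam, norm_qq]
  have h4 : (w : ℂ).im = w.im := rfl
  rw [h4]
  have h5 := Real.exp_pos (-2 * Real.pi * w.im)
  constructor <;> nlinarith

end GammaZero

namespace GammaZero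

lemma exists_norm_delta_smul_bounds {N : ℕ} (hN : 0 < N) (γ : SL(2, ℤ)) (g N' c' : ℤ) (hg : 0 < g)
    (hN' : 0 < N') (hgN : g * N' = N) (hgc : g * c' = γ 1 0) (hco : IsCoprime N' c') :
    ∃ A > 0, ∃ Y : ℝ, ∀ z : ℍ, Y ≤ z.im →
      ‖delta N hN (γ • z)‖ ≤
        A * (‖(γ 1 0 * z + γ 1 1 : ℂ)‖ ^ 12 * Real.exp (-2 * Real.pi * (g / N' * z.im))) ∧
      ‖(γ 1 0 * z + γ 1 1 : ℂ)‖ ^ 12 * Real.exp (-2 * Real.pi * (g / N' * z.im)) ≤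
        A * ‖delta N hN (γ • z)‖ := by
  obtain ⟨κ, hκ, h⟩ := exists_delta_smul_eq (hN := hN) γ g N' c' hg hN' hgN hgc hco
  obtain ⟨Y, hY⟩ := eventually_norm_discriminant
  have hκ' : 0 < ‖κ‖ := norm_pos_iff.2 hκ
  have hg' : (0 : ℝ) < g := by exact_mod_cast hg
  have hN0 : (0 : ℝ) < N' := by exact_mod_cast hN'
  refine ⟨2 * ‖κ‖ + 2 / ‖κ‖, by positivity, Y * N' / g, fun z hz => ?_⟩
  obtain ⟨w, hw, hd⟩ := h z
  have hwim : w.im = g / N' * z.im := by field_simp; linarith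
  have hYw : Y ≤ w.im := by
    rw [hwim]
    rw [div_le_iff₀ hg'] at hz
    rw [div_mul_eq_mul_div, le_div_iff₀ hN0]; linarith
  obtain ⟨h1, h2⟩ := hY w hYw
  rw [← hwim, hd, norm_mul, norm_mul, norm_pow]
  set j := ‖(γ 1 0 * z + γ 1 1 : ℂ)‖ ^ 12
  have hj : 0 ≤ j := by positivity
  set x := Real.exp (-2 * Real.pi * w.im)
  set y := ‖discriminant w‖
  have hy : 0 ≤ y := norm_nonneg _
  have hx : 0 ≤ x := by positivity
  constructor
  · calc ‖κ‖ * j * y ≤ ‖κ‖ * j * (2 * x) := by gcongr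
      _ = 2 * ‖κ‖ * (j * x) := by ring
      _ ≤ _ := by gcongr; linarith [div_pos two_pos hκ']
  · calc j * x ≤ j * (2 * y) := by gcongr; linarith
      _ = 2 / ‖κ‖ * (‖κ‖ * j * y) := by field_simp
      _ ≤ _ := by gcongr; linarith

lemma exists_norm_delta_div_le {N₁ N₂ : ℕ} (h₁ : 0 < N₁) (h₂ : 0 < N₂) (γ : SL(2, ℤ))
    (g₁ N₁' c₁ g₂ N₂' c₂ : ℤ) (hg₁ : 0 < g₁) (hN₁ : 0 < N₁') (hgN₁ : g₁ * N₁' = N₁)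
    (hgc₁ : g₁ * c₁ = γ 1 0) (hco₁ : IsCoprime N₁' c₁) (hg₂ : 0 < g₂) (hN₂ : 0 < N₂')
    (hgN₂ : g₂ * N₂' = N₂) (hgc₂ : g₂ * c₂ = γ 1 0) (hco₂ : IsCoprime N₂' c₂) :
    ∃ A Y : ℝ, ∀ z : ℍ, Y ≤ z.im → ‖delta N₁ h₁ (γ • z) / delta N₂ h₂ (γ • z)‖ ≤
      A * Real.exp (-2 * Real.pi * ((g₁ / N₁' - g₂ / N₂') * z.im)) := by
  obtain ⟨A₁, hA₁, Y₁, hY₁⟩ := exists_norm_delta_smul_bounds h₁ γ g₁ N₁' c₁ hg₁ hN₁ hgN₁ hgc₁ hco₁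
  obtain ⟨A₂, hA₂, Y₂, hY₂⟩ := exists_norm_delta_smul_bounds h₂ γ g₂ N₂' c₂ hg₂ hN₂ hgN₂ hgc₂ hco₂
  refine ⟨A₁ * A₂, max Y₁ Y₂, fun z hz => ?_⟩
  have h3 := (hY₁ z (le_trans (le_max_left _ _) hz)).1
  have h4 := (hY₂ z (le_trans (le_max_right _ _) hz)).2
  have h5 : 0 < ‖delta N₂ h₂ (γ • z)‖ := norm_pos_iff.2 (delta_ne_zero _)
  rw [norm_div, div_le_iff₀ h5]
  have h6 : Real.exp (-2 * Real.pi * (g₁ / N₁' * z.im)) =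
      Real.exp (-2 * Real.pi * ((g₁ / N₁' - g₂ / N₂') * z.im)) *
        Real.exp (-2 * Real.pi * (g₂ / N₂' * z.im)) := by
    rw [← Real.exp_add]; ring_nf
  rw [h6] at h3
  set j := ‖(γ 1 0 * z + γ 1 1 : ℂ)‖ ^ 12
  calc _ ≤ _ := h3
    _ = A₁ * Real.exp (-2 * Real.pi * ((g₁ / N₁' - g₂ / N₂') * z.im)) *
        (j * Real.exp (-2 * Real.pi * (g₂ / N₂' * z.im))) := by ring
    _ ≤ A₁ * Real.exp (-2 * Real.pi * ((g₁ / N₁' - g₂ / N₂') * z.im)) *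
        (A₂ * ‖delta N₂ h₂ (γ • z)‖) := by gcongr
    _ = _ := by ring

lemma isBoundedAtImInfty_delta_div {N₁ N₂ : ℕ} (h₁ : 0 < N₁) (h₂ : 0 < N₂) (γ : SL(2, ℤ))
    (g₁ N₁' c₁ g₂ N₂' c₂ : ℤ) (hg₁ : 0 < g₁) (hN₁ : 0 < N₁') (hgN₁ : g₁ * N₁' = N₁)
    (hgc₁ : g₁ * c₁ = γ 1 0) (hco₁ : IsCoprime N₁' c₁) (hg₂ : 0 < g₂) (hN₂ : 0 < N₂')
    (hgN₂ : g₂ * N₂' = N₂) (hgc₂ : g₂ * c₂ = γ 1 0) (hco₂ : IsCoprime N₂' c₂)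
    (hle : g₂ * N₁' ≤ g₁ * N₂') :
    IsBoundedAtImInfty fun z => delta N₁ h₁ (γ • z) / delta N₂ h₂ (γ • z) := by
  obtain ⟨A, Y, hA⟩ := exists_norm_delta_div_le h₁ h₂ γ g₁ N₁' c₁ g₂ N₂' c₂ hg₁ hN₁ hgN₁ hgc₁ hco₁
    hg₂ hN₂ hgN₂ hgc₂ hco₂
  rw [isBoundedAtImInfty_iff]
  refine ⟨|A|, Y, fun z hz => (hA z hz).trans ?_⟩
  have h3 : (0 : ℝ) ≤ g₁ / N₁' - g₂ / N₂' := by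
    rw [sub_nonneg, div_le_div_iff₀ (by exact_mod_cast hN₂) (by exact_mod_cast hN₁)]
    exact_mod_cast hle
  have h4 : Real.exp (-2 * Real.pi * ((g₁ / N₁' - g₂ / N₂') * z.im)) ≤ 1 := by
    rw [Real.exp_le_one_iff]
    have := mul_nonneg Real.pi_pos.le (mul_nonneg h3 z.im_pos.le)
    linarith
  have h5 := Real.exp_pos (-2 * Real.pi * ((g₁ / N₁' - g₂ / N₂') * z.im))
  calc _ ≤ |A| * Real.exp (-2 * Real.pi * ((g₁ / N₁' - g₂ / N₂') * z.im)) := by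
        gcongr; exact le_abs_self A
    _ ≤ |A| * 1 := by gcongr
    _ = |A| := mul_one _

lemma isCoprime_of_not_five_dvd {c : ℤ} (hc : ¬ 5 ∣ c) (k : ℕ) : IsCoprime ((5 : ℤ) ^ k) c :=
  ((Int.prime_iff_natAbs_prime.2
    (by norm_num : Nat.Prime (Int.natAbs 5))).coprime_iff_not_dvd.2 hc).pow_left

lemma mdifferentiable_inv {f : ℍ → ℂ} (hf : MDifferentiable 𝓘(ℂ) 𝓘(ℂ) f) (h0 : ∀ z, f z ≠ 0) :
    MDifferentiable 𝓘(ℂ) 𝓘(ℂ) fun z => (f z)⁻¹ := by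
  rw [mdifferentiable_iff] at hf ⊢
  exact hf.inv fun z _ => h0 _

lemma isModularFun_delta_div {N : ℕ} (hN : 0 < N) (hd : N = 1 ∨ N = 5) :
    IsModularFun fun z => delta N hN z / delta 25 (by norm_num) z where
  holo := by
    simp only [div_eq_mul_inv]
    exact mdifferentiable_delta.mul
      (mdifferentiable_inv mdifferentiable_delta fun z => delta_ne_zero z)
  inv γ h z := by
    have h1 : (N : ℤ) ∣ γ 1 0 := by
      rcases hd with rfl | rfl
      · simp
      · exact dvd_trans (by norm_num) h
    rw [delta_smul_of_dvd h1, delta_smul_of_dvd (by exact_mod_cast h),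
      mul_div_mul_left _ _ (pow_ne_zero _ (cocycle_ne_zero γ z))]
  bdd γ h := by
    by_cases h5 : (5 : ℤ) ∣ γ 1 0
    · obtain ⟨c', hc'⟩ := h5
      have h6 : ¬ 5 ∣ c' := fun ⟨d, hd⟩ => h ⟨d, by rw [hc', hd]; ring⟩
      rcases hd with rfl | rfl
      · exact isBoundedAtImInfty_delta_div _ _ γ 1 1 (γ 1 0) 5 5 c' one_pos one_pos (by norm_num)
          (by ring) isCoprime_one_left (by norm_num) (by norm_num) (by norm_num) hc'.symm
          (by simpa using isCoprime_of_not_five_dvd h6 1) (by norm_num)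
      · exact isBoundedAtImInfty_delta_div _ _ γ 5 1 c' 5 5 c' (by norm_num) one_pos (by norm_num)
          hc'.symm isCoprime_one_left (by norm_num) (by norm_num) (by norm_num) hc'.symm
          (by simpa using isCoprime_of_not_five_dvd h6 1) (by norm_num)
    · rcases hd with rfl | rfl
      · exact isBoundedAtImInfty_delta_div _ _ γ 1 1 (γ 1 0) 1 25 (γ 1 0)
          one_pos one_pos (by norm_num)
          (by ring) isCoprime_one_left (by norm_num) (by norm_num) (by norm_num) (by ring)
          (by simpa using isCoprime_of_not_five_dvd h5 2) (by norm_num)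
      · exact isBoundedAtImInfty_delta_div _ _ γ 1 5 (γ 1 0) 1 25 (γ 1 0) one_pos (by norm_num)
          (by norm_num)
          (by ring) (by simpa using isCoprime_of_not_five_dvd h5 1) (by norm_num) (by norm_num)
          (by norm_num) (by ring) (by simpa using isCoprime_of_not_five_dvd h5 2) (by norm_num)

/-- The quotient `Δ(z) / Δ(25 z)` stays away from zero at the cusps of width one. -/
lemma isBoundedAtImInfty_inv_delta_div {γ : SL(2, ℤ)} (h : ¬ (25 : ℤ) ∣ γ 1 0)
    (h5 : (5 : ℤ) ∣ γ 1 0) :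
    IsBoundedAtImInfty fun z => delta 25 (by norm_num) (γ • z) / delta 1 one_pos (γ • z) := by
  obtain ⟨c', hc'⟩ := h5
  have h6 : ¬ 5 ∣ c' := fun ⟨d, hd⟩ => h ⟨d, by rw [hc', hd]; ring⟩
  exact isBoundedAtImInfty_delta_div _ _ γ 5 5 c' 1 1 (γ 1 0) (by norm_num) (by norm_num)
    (by norm_num) hc'.symm (by simpa using isCoprime_of_not_five_dvd h6 1) one_pos one_pos
    (by norm_num) (by ring) isCoprime_one_left (by norm_num)

lemma exists_hasExp_delta_div {N : ℕ} (hN : 0 < N) (hd : N = 1 ∨ N = 5) :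
    ∃ c : PowerSeries ℂ, HasExp (fun z => delta N hN z / delta 25 (by norm_num) z) (25 - N) c ∧
      c * PowerSeries.map (Int.castRingHom ℂ)
        (PowerSeries.expand 25 (by norm_num) (PowerSeries.pentagonalSeries ℤ)) ^ 24 =
      PowerSeries.map (Int.castRingHom ℂ)
        (PowerSeries.expand N hN.ne' (PowerSeries.pentagonalSeries ℤ)) ^ 24 := by
  have hm := isModularFun_delta_div hN hd
  have hle : N ≤ 25 := by omega
  have hb : IsBoundedAtImInfty fun z : ℍ =>
      qq z ^ (25 - N) * (delta N hN z / delta 25 (by norm_num) z) := by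
    obtain ⟨A, Y, hA⟩ := exists_norm_delta_div_le hN (by norm_num : 0 < 25) 1 N 1 0 25 1 0
      (by exact_mod_cast hN) one_pos (by simp) (by simp) isCoprime_one_left (by norm_num) one_pos
      (by norm_num) (by simp) isCoprime_one_left
    rw [isBoundedAtImInfty_iff]
    refine ⟨A, Y, fun z hz => ?_⟩
    have h1 := hA z hz
    rw [one_smul] at h1
    rw [norm_mul, norm_pow, norm_qq, ← Real.exp_nat_mul, mul_comm]
    calc _ ≤ _ := mul_le_mul_of_nonneg_right h1 (Real.exp_pos _).le
      _ = A := by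
        rw [mul_assoc, ← Real.exp_add, Nat.cast_sub hle]
        have h2 : (z : ℂ).im = z.im := rfl
        rw [h2]; push_cast; ring_nf; simp
  obtain ⟨c, hc⟩ := exists_hasExp hm.holo hm.periodic hb
  refine ⟨c, hc, ?_⟩
  have h1 := hc.mul (hasExp_delta (hN := (by norm_num : 0 < 25)))
  have h2 := (hasExp_delta (hN := hN)).shift (25 - N)
  simp only [div_mul_cancel₀ _ (delta_ne_zero _), zero_add, add_zero] at h1 h2
  have h3 := h1.unique h2
  rw [← mul_assoc (PowerSeries.X ^ (25 - N)), ← pow_add, Nat.sub_add_cancel hle,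
      mul_left_comm] at h3
  exact mul_left_cancel₀ (pow_ne_zero _ PowerSeries.X_ne_zero) h3

end GammaZero

namespace GammaZero

namespace IsModularFun

variable {F : ℍ → ℂ}

lemma exists_tendsto_S_smul (hF : IsModularFun F) :
    ∃ C, Filter.Tendsto (fun z : ℍ => F (ModularGroup.S • z)) atImInfty (nhds C) := by
  have hper : ∀ z : ℍ, F (ModularGroup.S • ((25 : ℝ) +ᵥ z)) = F (ModularGroup.S • z) := by
    intro z
    have h1 : (25 : ℝ) +ᵥ z = ModularGroup.T ^ (25 : ℤ) • z := by
      rw [modular_T_zpow_smul]; norm_num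
    have h2 : ModularGroup.S • ModularGroup.T ^ (25 : ℤ) • z =
        (ModularGroup.S * ModularGroup.T ^ (25 : ℤ) * ModularGroup.S⁻¹) • ModularGroup.S • z := by
      rw [smul_smul, smul_smul, inv_mul_cancel_right]
    rw [h1, h2]
    refine hF.inv _ ?_ _
    rw [Matrix.SpecialLinearGroup.coe_mul, Matrix.SpecialLinearGroup.coe_mul,
      Matrix.SpecialLinearGroup.coe_inv, ModularGroup.coe_T_zpow, ModularGroup.coe_S]
    simp [Matrix.mul_apply, Fin.sum_univ_two]
  have hhol : MDifferentiable 𝓘(ℂ) 𝓘(ℂ) fun z : ℍ => F (ModularGroup.S • z) := by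
    exact hF.holo.comp (mdifferentiable_smul (g := (ModularGroup.S : GL (Fin 2) ℝ)) (by simp))
  have hb := hF.bdd ModularGroup.S (by simp [ModularGroup.S])
  have h := exp_decay_sub_atImInfty (h := 25) (by norm_num) (periodic_comp_ofComplex (h := 25) hper)
    hhol hb
  refine ⟨_, tendsto_sub_nhds_zero_iff.1 (h.trans_tendsto ?_)⟩
  have h1 : Filter.Tendsto (fun z : ℍ => z.im) atImInfty Filter.atTop := Filter.tendsto_comap
  have h2 : 0 < 2 * Real.pi / 25 := by positivity
  refine (Real.tendsto_exp_neg_atTop_nhds_zero.comp (h1.const_mul_atTop h2)).congr fun z => ?_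
  rw [Function.comp_apply]
  ring_nf

lemma tendsto_smul (hF : IsModularFun F) {C : ℂ}
    (hC : Filter.Tendsto (fun z : ℍ => F (ModularGroup.S • z)) atImInfty (nhds C)) {γ : SL(2, ℤ)}
    (hγ : ¬ (5 : ℤ) ∣ γ 1 0) : Filter.Tendsto (fun z : ℍ => F (γ • z)) atImInfty (nhds C) := by
  obtain ⟨a, b, hab⟩ := isCoprime_of_not_five_dvd hγ 2
  set j : ℤ := b * γ 1 1 with hj
  have h1 : ∀ z : ℍ, F (γ • z) = F (ModularGroup.S • ((j : ℝ) +ᵥ z)) := by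
    intro z
    have h2 : γ • z = (γ * ModularGroup.T ^ (-j) * ModularGroup.S⁻¹) •
        ModularGroup.S • ModularGroup.T ^ j • z := by
      rw [smul_smul, smul_smul]
      congr 1
      group
    rw [← modular_T_zpow_smul, h2]
    refine hF.inv _ ?_ _
    have h3 : (γ * ModularGroup.T ^ (-j) * ModularGroup.S⁻¹) 1 0 = γ 1 0 * j - γ 1 1 := by
      rw [Matrix.SpecialLinearGroup.coe_mul, Matrix.SpecialLinearGroup.coe_mul,
        Matrix.SpecialLinearGroup.coe_inv, ModularGroup.coe_T_zpow, ModularGroup.coe_S]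
      simp [Matrix.mul_apply, Fin.sum_univ_two]
      ring
    rw [h3]
    exact ⟨-a * γ 1 1, by rw [hj]; linear_combination (γ 1 1) * hab⟩
  simp only [h1]
  refine hC.comp ?_
  rw [atImInfty, Filter.tendsto_comap_iff]
  refine Filter.tendsto_comap.congr fun z => ?_
  simp

end IsModularFun

lemma IsModularFun.false_of_ne {F : ℍ → ℂ} (hF : IsModularFun F) {u : PowerSeries ℂ}
    (hu : PowerSeries.constantCoeff u = 1)
    (hFu : HasExp F 1 u) {C r : ℂ}
    (hC : Filter.Tendsto (fun z : ℍ => F (ModularGroup.S • z)) atImInfty (nhds C))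
    (hr : r ≠ C) (h0 : ∀ z, F z ≠ r)
    (hcusp : ∀ γ : SL(2, ℤ), ¬ (25 : ℤ) ∣ γ 1 0 → (5 : ℤ) ∣ γ 1 0 →
      IsBoundedAtImInfty fun z => (F (γ • z) - r)⁻¹) : False := by
  have h0' : ∀ z, F z - r ≠ 0 := fun z => sub_ne_zero.2 (h0 z)
  have hG : IsModularFun fun z => (F z - r)⁻¹ := by
    refine ⟨mdifferentiable_inv (hF.sub (.const r)).holo h0', fun γ hγ z => by rw [hF.inv γ hγ],
      fun γ hγ => ?_⟩
    by_cases h5 : (5 : ℤ) ∣ γ 1 0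
    · exact hcusp γ hγ h5
    · exact (((hF.tendsto_smul hC h5).sub_const r).inv₀ (sub_ne_zero.2 hr.symm)).isBigO_one ℝ
  have h1 : HasExp (fun z => F z - r) 1 (u - PowerSeries.X ^ 1 * PowerSeries.C r) :=
    hFu.sub ((HasExp.const r).shift 1)
  have h2 : Filter.Tendsto (fun z : ℍ => (F z - r)⁻¹) atImInfty (nhds 0) := by
    have h3 := tendsto_qq.mul (h1.tendsto.inv₀ (by simp [hu]))
    rw [zero_mul] at h3
    refine h3.congr fun z => ?_
    have := qq_ne_zero z
    have := h0' z
    field_simp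
  obtain ⟨a, ha⟩ := hG.eq_const_of_isBoundedAtImInfty (h2.isBigO_one ℝ)
  simp only [ha] at h2
  have h4 := tendsto_nhds_unique h2 tendsto_const_nhds
  exact inv_ne_zero (h0' I) (by rw [ha, h4])

lemma IsModularFun.polynomial_eval {F : ℍ → ℂ} (hF : IsModularFun F) (Q : Polynomial ℂ) :
    IsModularFun fun z => Q.eval (F z) := by
  simp only [Polynomial.eval_eq_sum_range]
  exact .sum _ fun k _ => (const _).mul (hF.pow k)

/-- A monic polynomial in `F` without zeros on the upper half plane, and without zeros at the
cusps of width one, is a power of `F - C`, where `C` is the value of `F` at the cusp `0`. -/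
lemma IsModularFun.eq_X_sub_C_pow {F : ℍ → ℂ} (hF : IsModularFun F) {u : PowerSeries ℂ}
    (hu : PowerSeries.constantCoeff u = 1) (hFu : HasExp F 1 u) {C : ℂ}
    (hC : Filter.Tendsto (fun z : ℍ => F (ModularGroup.S • z)) atImInfty (nhds C))
    {Q : Polynomial ℂ} (hQ : Q.Monic) (h0 : ∀ z, Q.eval (F z) ≠ 0)
    (hcusp : ∀ γ : SL(2, ℤ), ¬ (25 : ℤ) ∣ γ 1 0 → (5 : ℤ) ∣ γ 1 0 →
      IsBoundedAtImInfty fun z => (Q.eval (F (γ • z)))⁻¹) :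
    Q = (Polynomial.X - Polynomial.C C) ^ Q.natDegree := by
  have hroot : ∀ r ∈ Q.roots, r = C := by
    intro r hr
    by_contra hne
    obtain ⟨Q₁, hQ₁⟩ := Polynomial.dvd_iff_isRoot.2 (Polynomial.isRoot_of_mem_roots hr)
    have h1 : ∀ w, Q.eval w = (w - r) * Q₁.eval w := fun w => by rw [hQ₁]; simp
    refine hF.false_of_ne hu hFu hC hne (fun z hz => h0 z (by rw [h1, hz]; simp)) fun γ hγ h5 => ?_
    refine ((hcusp γ hγ h5).mul ((hF.polynomial_eval Q₁).bdd γ hγ)).congr_left fun z => ?_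
    have h2 := h0 (γ • z)
    simp only [Pi.mul_apply]
    rw [h1] at h2 ⊢
    have h3 := left_ne_zero_of_mul h2
    have h4 := right_ne_zero_of_mul h2
    field_simp
  have hs := IsAlgClosed.splits Q
  have h5 : Q.roots = Multiset.replicate Q.natDegree C :=
    Multiset.eq_replicate.2 ⟨hs.natDegree_eq_card_roots.symm, hroot⟩
  conv_lhs => rw [hs.eq_prod_roots_of_monic hQ, h5]
  simp

end GammaZero

namespace PowerSeries

lemma coeff_pentagonalSeries_of_lt {n : ℕ} (hn : n < 22) :
    coeff n (pentagonalSeries ℤ) = if n = 0 ∨ n = 5 ∨ n = 7 then 1 else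
      if n = 1 ∨ n = 2 ∨ n = 12 ∨ n = 15 then -1 else 0 := by
  by_cases h : n ∈ Set.range pentagonal
  · obtain ⟨k, rfl⟩ := h
    have h1 := two_mul_natCast_pentagonal k
    have h2 : (pentagonal k : ℤ) < 22 := by exact_mod_cast hn
    have h3 : -4 < k := by nlinarith
    have h4 : k < 4 := by nlinarith
    rw [coeff_pentagonalSeries_pentagonal]
    clear h1 h2 hn
    interval_cases k <;> decide
  · rw [coeff_pentagonalSeries_eq_zero _ h, if_neg, if_neg]
    · rintro (rfl | rfl | rfl | rfl)
      · exact h ⟨1, rfl⟩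
      · exact h ⟨-1, rfl⟩
      · exact h ⟨3, rfl⟩
      · exact h ⟨-3, rfl⟩
    · rintro (rfl | rfl | rfl)
      · exact h ⟨0, rfl⟩
      · exact h ⟨2, rfl⟩
      · exact h ⟨-2, rfl⟩

lemma X_pow_dvd_pentagonalSeries_sub :
    X ^ 21 ∣ pentagonalSeries ℤ - (1 - X - X ^ 2 + X ^ 5 + X ^ 7 - X ^ 12 - X ^ 15) := by
  rw [X_pow_dvd_iff]
  intro n hn
  simp only [map_sub, map_add, coeff_pentagonalSeries_of_lt (hn.trans (by norm_num)), coeff_X_pow,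
    coeff_X, coeff_one]
  interval_cases n <;> rfl

lemma X_pow_dvd_expand_sub {d k m : ℕ} (hd : d ≠ 0) (hm : m ≤ d * k) {f g : ℤ⟦X⟧}
    (h : X ^ k ∣ f - g) :
    X ^ m ∣ expand d hd f - expand d hd g := by
  rw [← map_sub]
  obtain ⟨r, hr⟩ := h
  rw [hr, map_mul, map_pow, expand_X, ← pow_mul]
  exact dvd_mul_of_dvd_left (pow_dvd_pow X hm) _

lemma pow_dvd_pentagonal_relation {R : Type*} [CommRing R] (x : R) :
    x ^ 21 ∣ ((1 - x - x ^ 2 + x ^ 5 + x ^ 7 - x ^ 12 - x ^ 15) ^ 5 +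
      5 * x * (1 - x - x ^ 2 + x ^ 5 + x ^ 7 - x ^ 12 - x ^ 15) ^ 4 +
      15 * x ^ 2 * (1 - x - x ^ 2 + x ^ 5 + x ^ 7 - x ^ 12 - x ^ 15) ^ 3 +
      25 * x ^ 3 * (1 - x - x ^ 2 + x ^ 5 + x ^ 7 - x ^ 12 - x ^ 15) ^ 2 +
      25 * x ^ 4 * (1 - x - x ^ 2 + x ^ 5 + x ^ 7 - x ^ 12 - x ^ 15)) -
      (1 - x ^ 5 - x ^ 10) ^ 6 :=
  ⟨-5 * x + 5 * x ^ 3 + 7 * x ^ 4 - 5 * x ^ 5 - 10 * x ^ 6 + 5 * x ^ 7 - 96 * x ^ 9 + 10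
      * x ^ 10 - 20 * x ^ 12 - 5 * x ^ 13 + 70 * x ^ 14 - 10 * x ^ 15 + 25 * x ^ 16 + 45 *
      x ^ 17 - 5 * x ^ 18 + 15 * x ^ 19 + 5 * x ^ 20 + 20 * x ^ 21 - 65 * x ^ 22 + 15 * x ^
      23 + 40 * x ^ 24 - 10 * x ^ 25 - 15 * x ^ 26 + 65 * x ^ 27 - 10 * x ^ 28 - 44 * x ^
      29 + 30 * x ^ 30 - 30 * x ^ 31 - 45 * x ^ 32 - 10 * x ^ 33 - 11 * x ^ 34 - 40 * x ^
      35 + 20 * x ^ 37 + 3 * x ^ 39 + 30 * x ^ 40 + 15 * x ^ 41 - 5 * x ^ 42 + 20 * x ^ 43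
      + 5 * x ^ 44 - 10 * x ^ 45 + 5 * x ^ 46 - 10 * x ^ 48 - 5 * x ^ 51 - x ^ 54, by ring⟩

lemma X_pow_dvd_pentagonalSeries_relation {e e₅ e₂₅ : ℤ⟦X⟧}
    (h₁ : X ^ 21 ∣ e - (1 - X - X ^ 2 + X ^ 5 + X ^ 7 - X ^ 12 - X ^ 15))
    (h₅ : X ^ 21 ∣ e₅ - (1 - X ^ 5 - X ^ 10)) (h₂₅ : X ^ 21 ∣ e₂₅ - 1) :
    X ^ 21 ∣ e₅ ^ 24 - (e ^ 5 + 5 * X * e ^ 4 * e₂₅ + 15 * X ^ 2 * e ^ 3 * e₂₅ ^ 2 +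
      25 * X ^ 3 * e ^ 2 * e₂₅ ^ 3 + 25 * X ^ 4 * e * e₂₅ ^ 4) ^ 4 * e₂₅ ^ 4 := by
  have hT := pow_dvd_pentagonal_relation (X : ℤ⟦X⟧)
  simp only [← Ideal.mem_span_singleton, ← Ideal.Quotient.eq_zero_iff_mem, map_sub, sub_eq_zero]
    at h₁ h₅ h₂₅ hT ⊢
  simp only [map_mul, map_add, map_pow, h₂₅] at hT ⊢
  simp only [map_sub, map_add, map_pow, map_one, mul_one, one_pow, h₁, h₅] at hT ⊢
  rw [hT]
  ring

/-- Roots of power series with constant coefficient one are unique. -/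
lemma eq_of_pow_eq_pow {R : Type*} [CommRing R] [IsDomain R] [CharZero R] {x y : R⟦X⟧} {n : ℕ}
    (hn : n ≠ 0) (hx : constantCoeff x = 1) (hy : constantCoeff y = 1) (h : x ^ n = y ^ n) :
    x = y := by
  have h1 := Commute.geom_sum₂_mul (Commute.all x y) n
  rw [h, sub_self] at h1
  refine sub_eq_zero.1 ((mul_eq_zero.1 h1).resolve_left fun h0 => ?_)
  have h2 := congrArg constantCoeff h0
  simp [hx, hy, hn] at h2

lemma constantCoeff_pentagonalSeries :
    PowerSeries.constantCoeff (PowerSeries.pentagonalSeries ℤ) = 1 := by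
  rw [← PowerSeries.coeff_zero_eq_constantCoeff_apply,
    PowerSeries.coeff_pentagonalSeries_of_lt (by norm_num)]
  rfl

lemma constantCoeff_map {R S : Type*} [Semiring R] [Semiring S] (φ : R →+* S)
    (f : PowerSeries R) : PowerSeries.constantCoeff (PowerSeries.map φ f) =
      φ (PowerSeries.constantCoeff f) := by
  simp only [← PowerSeries.coeff_zero_eq_constantCoeff_apply, PowerSeries.coeff_map]

end PowerSeries

namespace GammaZero

open PowerSeries in
lemma IsModularFun.exists_delta_div_eq {F : ℍ → ℂ} (hF : IsModularFun F) {u : PowerSeries ℂ}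
    (hu : constantCoeff u = 1) (hFu : HasExp F 1 u) :
    ∃ C : ℂ, ∀ z, delta 1 one_pos z / delta 25 (by norm_num) z = (F z - C) ^ 24 := by
  obtain ⟨C, hC⟩ := hF.exists_tendsto_S_smul
  obtain ⟨δ, hδ, hδ'⟩ := exists_hasExp_delta_div one_pos (.inl rfl)
  obtain ⟨r, hr, hD, -⟩ :=
      (isModularFun_delta_div one_pos (.inl rfl)).exists_eq_sum_pow (RingHom.id ℂ)
    (N := 24) (u := u) (g := δ) hF hu (by simpa using hFu) (by simpa using hδ)
  have hδ1 : constantCoeff δ = 1 := by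
    have h := congrArg constantCoeff hδ'
    simpa [constantCoeff_map, constantCoeff_pentagonalSeries] using h
  set Q : Polynomial ℂ := ∑ k ∈ Finset.range 25, Polynomial.C (r k) * Polynomial.X ^ k with hQ
  have hQe : ∀ w, Q.eval w = ∑ k ∈ Finset.range 25, r k * w ^ k := fun w => by
    simp [hQ, Polynomial.eval_finsetSum]
  have hdeg : (∑ k ∈ Finset.range 24, Polynomial.C (r k) * Polynomial.X ^ k : Polynomial ℂ).degree <
      (24 : ℕ) := by
    refine (Polynomial.degree_sum_le _ _).trans_lt ((Finset.sup_lt_iff ?_).2 fun k hk => ?_)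
    · exact WithBot.bot_lt_coe _
    · exact (Polynomial.degree_C_mul_X_pow_le _ _).trans_lt
        (by exact_mod_cast Finset.mem_range.1 hk)
  have hQ1 : Q = Polynomial.X ^ 24 + ∑ k ∈ Finset.range 24, Polynomial.C (r k) *
      Polynomial.X ^ k := by
    rw [hQ, Finset.sum_range_succ, hr, hδ1, Polynomial.C_1, one_mul, add_comm]
  have hmonic : Q.Monic := by rw [hQ1]; exact Polynomial.monic_X_pow_add hdeg
  have hnat : Q.natDegree = 24 := by
    rw [hQ1]
    exact Polynomial.natDegree_eq_of_degree_eq_some (by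
      rw [Polynomial.degree_add_eq_left_of_degree_lt (by rwa [Polynomial.degree_X_pow]),
        Polynomial.degree_X_pow])
  have hDQ : ∀ z, delta 1 one_pos z / delta 25 (by norm_num) z = Q.eval (F z) := fun z => by
    rw [hD z, hQe]; rfl
  refine ⟨C, fun z => ?_⟩
  have h := hF.eq_X_sub_C_pow hu hFu hC hmonic
    (fun z => by rw [← hDQ]; exact div_ne_zero (delta_ne_zero z) (delta_ne_zero z))
    fun γ h25 h5 => by
      simp only [← hDQ, inv_div]
      exact isBoundedAtImInfty_inv_delta_div h25 h5
  rw [hDQ, h, hnat]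
  simp

open PowerSeries in
lemma IsModularFun.exists_hauptmodulPair {F : ℍ → ℂ} (hF : IsModularFun F) {u : PowerSeries ℂ}
    (hu : constantCoeff u = 1) (hFu : HasExp F 1 u) :
    ∃ (C : ℂ) (v : PowerSeries ℤ) (s t : (LaurentSeries ℤ)ˣ), constantCoeff v = 1 ∧
      HasExp (fun z => F z - C) 1 (PowerSeries.map (Int.castRingHom ℂ) v) ∧
      FormalLaurent.HauptmodulPair s t ∧
      (s : LaurentSeries ℤ) = HahnSeries.single (-1) 1 * HahnSeries.ofPowerSeries ℤ ℤ v := by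
  obtain ⟨C, hC⟩ := hF.exists_delta_div_eq hu hFu
  obtain ⟨δ, hδ, hδ'⟩ := exists_hasExp_delta_div one_pos (.inl rfl)
  obtain ⟨ε, hε, hε'⟩ := exists_hasExp_delta_div (by norm_num : 0 < 5) (.inr rfl)
  have hinj : Function.Injective (PowerSeries.map (Int.castRingHom ℂ)) :=
    map_injective _ (RingHom.injective_int _)
  set e : ℤ⟦X⟧ := pentagonalSeries ℤ with he
  have he1 : expand 1 one_ne_zero e = e := by simp
  rw [he1] at hδ'
  set e₅ := expand 5 (by norm_num) e with he₅
  set e₂₅ := expand 25 (by norm_num) e with he₂₅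
  have hce : constantCoeff e = 1 := by
    rw [he, constantCoeff_pentagonalSeries]
  have hce₅ : constantCoeff e₅ = 1 := by simp [he₅, hce]
  have hce₂₅ : constantCoeff e₂₅ = 1 := by simp [he₂₅, hce]
  set w : ℤ⟦X⟧ := invOfUnit e₂₅ 1 with hw
  have hwe : e₂₅ * w = 1 := mul_invOfUnit _ _ (by simpa using hce₂₅)
  have hwe' : PowerSeries.map (Int.castRingHom ℂ) e₂₅ * PowerSeries.map (Int.castRingHom ℂ) w =
      1 := by
    rw [← map_mul, hwe, map_one]
  set v := e * w with hv
  have hve : v * e₂₅ = e := by rw [hv, mul_assoc, mul_comm w, hwe, mul_one]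
  have hs : HasExp (fun z => F z - C) 1 (u - X ^ 1 * PowerSeries.C C) :=
    hFu.sub ((HasExp.const C).shift 1)
  have hcu : constantCoeff (u - X ^ 1 * PowerSeries.C C) = 1 := by simp [hu]
  have hδu : δ = (u - X ^ 1 * PowerSeries.C C) ^ 24 := by
    refine hδ.unique ?_
    simp only [hC]
    exact hs.pow 24
  have huv : u - X ^ 1 * PowerSeries.C C = PowerSeries.map (Int.castRingHom ℂ) v := by
    rw [hδu, ← mul_pow] at hδ'
    have h := eq_of_pow_eq_pow (by norm_num) (by simp [hu, constantCoeff_map, hce₂₅])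
      (by simp [constantCoeff_map, hce]) hδ'
    rw [← mul_one (u - _), ← hwe', ← mul_assoc, h, hv, map_mul]
  rw [huv] at hs hcu
  have hcv : constantCoeff v = 1 := by simpa [hce₂₅, hce] using congrArg constantCoeff hve
  set P : ℤ⟦X⟧ := v ^ 5 + 5 * X * v ^ 4 + 15 * X ^ 2 * v ^ 3 + 25 * X ^ 3 * v ^ 2 + 25 * X ^ 4 * v
    with hP
  have hsm : IsModularFun fun z => F z - C := hF.sub (.const C)
  obtain ⟨p, hpm, hp⟩ : ∃ p : ℍ → ℂ,
      IsModularFun p ∧ HasExp p 5 (PowerSeries.map (Int.castRingHom ℂ) P) := by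
    have hk : ∀ (a : ℤ) (i j : ℕ), j * 1 + i = 5 → HasExp (fun z => (a : ℂ) * (F z - C) ^ j) 5
        (PowerSeries.map (Int.castRingHom ℂ) (PowerSeries.C a * (X ^ i * v ^ j))) := by
      intro a i j hij
      have h := (HasExp.const (a : ℂ)).mul ((hs.pow j).shift i)
      rw [hij, zero_add] at h
      simpa using h
    have hkm : ∀ (a : ℤ) (j : ℕ), IsModularFun (fun z => (a : ℂ) * (F z - C) ^ j) :=
      fun a j => (IsModularFun.const _).mul (hsm.pow j)
    refine ⟨_, ((((hkm 1 5).add (hkm 5 4)).add (hkm 15 3)).add (hkm 25 2)).add (hkm 25 1), ?_⟩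
    convert ((((hk 1 0 5 rfl).add (hk 5 1 4 rfl)).add (hk 15 2 3 rfl)).add (hk 25 3 2 rfl)).add
      (hk 25 4 1 rfl) using 1
    simp only [hP, ← map_add]
    congr 1
    simp only [map_ofNat, map_one]
    ring
  have hdvd : X ^ 21 ∣ e₅ ^ 24 - P ^ 4 * e₂₅ ^ 24 := by
    have h₅ : X ^ 21 ∣ e₅ - (1 - X ^ 5 - X ^ 10) := by
      have h := X_pow_dvd_expand_sub (d := 5) (k := 5) (m := 21) (by norm_num) (by norm_num)
        (f := e) (g := 1 - X - X ^ 2) ?_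
      · simpa [← pow_mul] using h
      · rw [X_pow_dvd_iff]
        intro n hn
        simp only [he, map_sub, coeff_pentagonalSeries_of_lt (hn.trans (by norm_num)), coeff_X_pow,
          coeff_X, coeff_one]
        interval_cases n <;> rfl
    have h₂₅ : X ^ 21 ∣ e₂₅ - 1 := by
      have h := X_pow_dvd_expand_sub (d := 25) (k := 1) (m := 21) (by norm_num) (by norm_num)
        (f := e) (g := 1) ?_
      · simpa using h
      · rw [pow_one, X_dvd_iff]; simp [hce]
    convert X_pow_dvd_pentagonalSeries_relation X_pow_dvd_pentagonalSeries_sub h₅ h₂₅ using 2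
    rw [← he, ← hve, hP]
    ring
  have hεP : ε = PowerSeries.map (Int.castRingHom ℂ) P ^ 4 := by
    obtain ⟨y, hy⟩ := hdvd
    have h1 : ε - PowerSeries.map (Int.castRingHom ℂ) P ^ 4 =
        X ^ (20 + 1) * (PowerSeries.map (Int.castRingHom ℂ) (y * w ^ 24)) := by
      have h2 := congrArg (PowerSeries.map (Int.castRingHom ℂ)) hy
      simp only [map_sub, map_mul, map_pow, PowerSeries.map_X] at h2 ⊢
      have h3 : (PowerSeries.map (Int.castRingHom ℂ) e₂₅ *
          PowerSeries.map (Int.castRingHom ℂ) w) ^ 24 = 1 := by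
        rw [hwe', one_pow]
      rw [← hε'] at h2
      linear_combination (PowerSeries.map (Int.castRingHom ℂ) w) ^ 24 * h2 +
        (PowerSeries.map (Int.castRingHom ℂ) P ^ 4 - ε) * h3
    have h2 := hε.sub (hp.pow 4)
    rw [h1] at h2
    have h3 := (((isModularFun_delta_div (by norm_num) (.inr rfl)).sub
      (hpm.pow 4)).eq_zero_of_hasExp h2).2
    rw [h3, mul_zero] at h1
    exact sub_eq_zero.1 h1
  have h2 : P * e₂₅ ^ 6 = e₅ ^ 6 := by
    apply hinj
    refine eq_of_pow_eq_pow (n := 4) (by norm_num) ?_ ?_ ?_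
    · simp [hP, constantCoeff_map, hce₂₅, hcv]
    · simp [constantCoeff_map, hce₅]
    · rw [hεP] at hε'
      simp only [map_mul, map_pow]
      linear_combination hε'
  obtain ⟨s, t, hst, hsv⟩ := FormalLaurent.exists_hauptmodulPair (e := e) (u := v)
    (by simp [he, coeff_pentagonalSeries_of_lt]) (by simp [he, coeff_pentagonalSeries_of_lt])
    (by simp [he, coeff_pentagonalSeries_of_lt]) (by simp [he, coeff_pentagonalSeries_of_lt])
    (by simp [he, coeff_pentagonalSeries_of_lt]) hve h2
  exact ⟨C, v, s, t, hcv, hs, hst, hsv⟩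

end GammaZero

namespace FormalLaurent

lemma evalInt_sum_monomial {x : LaurentSeries ℤ} {v : PowerSeries ℤ}
    (hx : x = HahnSeries.single (-1) 1 * HahnSeries.ofPowerSeries ℤ ℤ v) (m : ℕ) (r : ℕ → ℤ) :
    evalInt x (∑ k ∈ Finset.range (m + 1), Polynomial.monomial k (r k)) =
      HahnSeries.single (-(m : ℤ)) 1 * HahnSeries.ofPowerSeries ℤ ℤ
        (∑ k ∈ Finset.range (m + 1), PowerSeries.C (r k) * (PowerSeries.X ^ (m - k) * v ^ k)) := by
  rw [map_sum, map_sum, Finset.mul_sum]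
  refine Finset.sum_congr rfl fun k hk => ?_
  have hk' : k ≤ m := Nat.lt_succ_iff.1 (Finset.mem_range.1 hk)
  rw [evalInt_monomial, hx, mul_pow, single_neg_one_pow, map_mul, map_mul, map_pow, map_pow,
    HahnSeries.ofPowerSeries_X, HahnSeries.single_pow, one_pow]
  have h1 : (HahnSeries.single (-(k : ℤ)) 1 : LaurentSeries ℤ) =
      HahnSeries.single (-(m : ℤ)) 1 * HahnSeries.single ((m - k) • (1 : ℤ)) 1 := by
    rw [HahnSeries.single_mul_single, mul_one, nsmul_eq_mul, mul_one,
      show -(m : ℤ) + ((m - k : ℕ) : ℤ) = -(k : ℤ) by omega]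
  have hC : HahnSeries.ofPowerSeries ℤ ℤ (PowerSeries.C (r k)) = ((r k : ℤ) : LaurentSeries ℤ) := by
    rw [eq_intCast PowerSeries.C, map_intCast]
  rw [h1, hC]
  ring

end FormalLaurent

/-- Divisibility of `a₀⁽²⁵⁾(5^α m', 5^β n')` by powers of 5 when `α ≠ β`. -/
theorem congruences_level25 (f25 : ℕ → ℍ → ℂ) (a25 : ℕ → ℕ → ℤ)
    (h25 : ∀ m, IsCanonicalBasis0 25 m (f25 m) (a25 m)) :
    ∀ α β m' n' : ℕ, ¬ 5 ∣ m' → ¬ 5 ∣ n' →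
      (β < α → (5 : ℤ) ^ (2 * (α - β) + 1) ∣ a25 (5 ^ α * m') (5 ^ β * n')) ∧
      (α < β → (5 : ℤ) ^ ((β - α) + 1) ∣ a25 (5 ^ α * m') (5 ^ β * n')) := by
  have hcc : ∀ m, PowerSeries.constantCoeff (GammaZero.canonicalSeries m (a25 m)) = 1 := fun m => by
    rw [← PowerSeries.coeff_zero_eq_constantCoeff_apply, GammaZero.canonicalSeries,
      PowerSeries.coeff_mk, if_pos rfl]
  obtain ⟨C, v, s, t, hv, hs, hst, hsv⟩ :=
    (GammaZero.isModularFun_of_isCanonicalBasis (h25 1)).exists_hauptmodulPair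
      (by rw [PowerSeries.constantCoeff_map, hcc, map_one])
      (GammaZero.hasExp_of_isCanonicalBasis le_rfl (h25 1))
  have hsm := (GammaZero.isModularFun_of_isCanonicalBasis (h25 1)).sub (.const C)
  have key : ∀ m : ℕ, ∃ p : Polynomial ℤ, 1 ≤ m → FormalLaurent.evalInt (s : LaurentSeries ℤ) p =
      HahnSeries.single (-(m : ℤ)) 1 *
        HahnSeries.ofPowerSeries ℤ ℤ (GammaZero.canonicalSeries m (a25 m)) := by
    intro m
    rcases Nat.lt_or_ge m 1 with hm | hm
    · exact ⟨0, fun h => absurd h hm.not_ge⟩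
    obtain ⟨r, -, -, hr⟩ :=
      (GammaZero.isModularFun_of_isCanonicalBasis (h25 m)).exists_eq_sum_pow (Int.castRingHom ℂ)
        hsm hv hs (GammaZero.hasExp_of_isCanonicalBasis hm (h25 m))
    refine ⟨_, fun _ => (FormalLaurent.evalInt_sum_monomial hsv m r).trans ?_⟩
    rw [← PowerSeries.map_injective _ (RingHom.injective_int _) hr]
  choose p hp using key
  refine hst.pow_dvd_coeff (p := p) (fun m hm n hn => ?_) fun m hm n hn => ?_
  · rw [hp m hm, FormalLaurent.coeff_single_mul_ofPowerSeries, GammaZero.canonicalSeries,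
      PowerSeries.coeff_mk]
    grind
  · rw [hp m hm, FormalLaurent.coeff_single_mul_ofPowerSeries, GammaZero.canonicalSeries,
      PowerSeries.coeff_mk, if_neg (by omega), if_neg (by omega), if_neg (by omega)]
    congr 1
    omega
end

section
/- The modular j-function satisfies j = psi3 + 756 + 196830·phi3 + 19131876·phi3² + 387420489·phi3³, where psi3(z) = (η(z)/η(3z))^{12} and phi3 = 1/psi3. -/
open Complex UpperHalfPlane

def sigma' (k n : ℕ) : ℕ := ∑ d ∈ n.divisors, d ^ k

noncomputable def E4 (z : ℂ) : ℂ := 1 + 240 * ∑' n : ℕ, (sigma' 3 (n + 1) : ℂ) * qq z ^ (n + 1)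

noncomputable def Δfun (z : ℂ) : ℂ := dedekindEta z ^ 24

noncomputable def jfun (z : ℂ) : ℂ := E4 z ^ 3 / Δfun z

noncomputable def psi3 (z : ℂ) : ℂ := (dedekindEta z / dedekindEta (3 * z)) ^ 12

noncomputable def phi3 (z : ℂ) : ℂ := (psi3 z)⁻¹

open scoped MatrixGroups Manifold Topology ModularForm

lemma slash_zero_apply (f : ℍ → ℂ) (γ : SL(2, ℤ)) (z : ℍ) :
    (f ∣[(0 : ℤ)] γ) z = f (γ • z) := by
  simp [ModularForm.SL_slash_apply]

lemma S_smul_S_smul (z : ℍ) : ModularGroup.S • ModularGroup.S • z = z := by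
  rw [smul_smul, show ModularGroup.S * ModularGroup.S = -1 by decide,
    ModularGroup.SL_neg_smul, one_smul]

lemma S_smul_T_smul_S_smul (z : ℍ) :
    ModularGroup.S • ModularGroup.T • ModularGroup.S • z =
      ModularGroup.T⁻¹ • ModularGroup.S • ModularGroup.T⁻¹ • z := by
  simp only [smul_smul]
  rw [show ModularGroup.S * (ModularGroup.T * ModularGroup.S) =
    ModularGroup.T⁻¹ * (ModularGroup.S * ModularGroup.T⁻¹) by decide]

lemma isBoundedAtImInfty_comp_T {f : ℍ → ℂ} (hf : IsBoundedAtImInfty f) :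
    IsBoundedAtImInfty fun z ↦ f (ModularGroup.T • z) := by
  rw [isBoundedAtImInfty_iff] at hf ⊢
  obtain ⟨M, A, h⟩ := hf
  refine ⟨M, A, fun z hz ↦ h _ ?_⟩
  rw [modular_T_smul]
  simpa using hz

/-- A holomorphic function of weight zero on `Γ₀(3)` which vanishes at the cusp `∞` and is bounded
at the cusp `0` is zero. The group `Γ₀(3)` enters through its generators `T` and `S T³ S`. -/
lemma eq_zero_of_gamma0_three_invariant {g : ℍ → ℂ} (hg : MDiff g)
    (hT : ∀ z : ℍ, g (ModularGroup.T • z) = g z)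
    (hU : ∀ z : ℍ, g (ModularGroup.S • ModularGroup.T • ModularGroup.T • ModularGroup.T • z) =
      g (ModularGroup.S • z))
    (hzero : IsZeroAtImInfty g)
    (hbdd : IsBoundedAtImInfty fun z ↦ g (ModularGroup.S • z)) : g = 0 := by
  have hT' (z : ℍ) : g (ModularGroup.T⁻¹ • z) = g z := by
    rw [← hT, smul_inv_smul]
  have hSTS (z : ℍ) : g (ModularGroup.S • ModularGroup.T • ModularGroup.S • z) =
      g (ModularGroup.S • ModularGroup.T • ModularGroup.T • z) := by
    rw [S_smul_T_smul_S_smul, hT', ← hU, smul_inv_smul]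
  let F : Fin 4 → ℍ → ℂ := ![g, g ∣[(0 : ℤ)] ModularGroup.S,
    g ∣[(0 : ℤ)] (ModularGroup.S * ModularGroup.T),
    g ∣[(0 : ℤ)] (ModularGroup.S * ModularGroup.T * ModularGroup.T)]
  have hF (i) : MDiff (F i) := by
    fin_cases i
    · exact hg
    all_goals exact hg.slash _ _
  have happly (z : ℍ) : (∏ i, F i) z = g z * g (ModularGroup.S • z) *
      g (ModularGroup.S • ModularGroup.T • z) *
      g (ModularGroup.S • ModularGroup.T • ModularGroup.T • z) := by
    simp [F, Fin.prod_univ_four, slash_zero_apply, mul_smul]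
  have hzeroF : IsZeroAtImInfty (∏ i, F i) := by
    have h1 := isBoundedAtImInfty_comp_T hbdd
    have h2 := isBoundedAtImInfty_comp_T h1
    have := ((hzero.mul_boundedAtFilter hbdd).mul_boundedAtFilter h1).mul_boundedAtFilter h2
    rwa [show (∏ i, F i) = _ from funext happly]
  have hinvS : (∏ i, F i) ∣[(0 : ℤ)] ModularGroup.S = ∏ i, F i := by
    ext z
    have hSTTS := hSTS (ModularGroup.S • z)
    rw [S_smul_S_smul] at hSTTS
    rw [slash_zero_apply, happly, happly, S_smul_S_smul, hSTS, ← hSTTS]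
    ring
  have hinvT : (∏ i, F i) ∣[(0 : ℤ)] ModularGroup.T = ∏ i, F i := by
    ext z
    rw [slash_zero_apply, happly, happly, hT, hU]
    ring
  have hinv := SlashInvariantForm.slash_action_generators_SL2Z hinvS hinvT
  let P : CuspForm 𝒮ℒ 0 :=
    { toFun := ∏ i, F i
      slash_action_eq' := by
        rintro _ ⟨γ, rfl⟩
        exact hinv γ
      holo' := MDifferentiable.prod fun i _ ↦ hF i
      zero_at_cusps' := by
        intro c hc
        rw [Subgroup.IsArithmetic.isCusp_iff_isCusp_SL2Z] at hc
        rw [OnePoint.isZeroAt_iff_forall_SL2Z hc]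
        intro γ _
        rw [hinv]
        exact hzeroF }
  have hP : P = 0 := rank_zero_iff_forall_zero.mp
    (CuspForm.rank_eq_zero_of_weight_lt_twelve (by norm_num)) P
  have hprod : ∏ i, F i = 0 := congrArg DFunLike.coe hP
  obtain ⟨i, -, hi⟩ := (UpperHalfPlane.prod_eq_zero_iff fun i _ ↦ hF i).mp hprod
  obtain ⟨γ, hγ⟩ : ∃ γ : SL(2, ℤ), ∀ z, g (γ • z) = 0 := by
    fin_cases i
    · exact ⟨1, fun z ↦ by simpa using! congrFun hi z⟩
    all_goals exact ⟨_, fun z ↦ (slash_zero_apply g _ z).symm.trans (congrFun hi z)⟩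
  ext z
  simpa using hγ (γ⁻¹ • z)

/-- The Euler product `∏ (1 - qⁿ)` over `n ≥ 1`. -/
noncomputable def eulerProduct (q : ℂ) : ℂ := ∏' n : ℕ, (1 - q ^ (n + 1))

lemma eulerProduct_zero : eulerProduct 0 = 1 := by
  simp [eulerProduct]

lemma eulerProduct_ne_zero {q : ℂ} (hq : ‖q‖ < 1) : eulerProduct q ≠ 0 := by
  simp only [eulerProduct, sub_eq_add_neg]
  refine tprod_one_add_ne_zero_of_summable (fun n h ↦ ?_) ?_
  · have h' : q ^ (n + 1) = 1 := by linear_combination -h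
    have := pow_lt_one₀ (norm_nonneg q) hq n.succ_ne_zero
    rw [← norm_pow, h', norm_one] at this
    exact this.false
  · simpa using (summable_nat_add_iff 1).mpr (summable_geometric_of_lt_one (norm_nonneg _) hq)

lemma differentiableAt_eulerProduct_zero : DifferentiableAt ℂ eulerProduct 0 :=
  ModularForm.differentiableOn_tprod_one_sub_pow.differentiableAt (Metric.ball_mem_nhds _ one_pos)

lemma hasDerivAt_eulerProduct_zero : HasDerivAt eulerProduct (-1) 0 := by
  have hterm (n : ℕ) (hn : n ∉ ({0} : Finset ℕ)) :
      logDeriv (fun q : ℂ ↦ 1 - q ^ (n + 1)) 0 = 0 := by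
    simp [logDeriv_apply, show n ≠ 0 by simpa using hn]
  have h := logDeriv_tprod_eq_tsum (f := fun (n : ℕ) (q : ℂ) ↦ 1 - q ^ (n + 1))
    (x := 0) Metric.isOpen_ball (Metric.mem_ball_self one_pos)
    (fun n ↦ by simp) (fun n ↦ by fun_prop)
    (summable_of_ne_finset_zero (s := {0}) hterm)
    ModularForm.multipliableLocallyUniformlyOn_one_sub_pow
    (eulerProduct_ne_zero (by simp))
  rw [tsum_eq_sum (s := {0}) hterm] at h
  have hderiv : deriv eulerProduct 0 = -1 := by
    change logDeriv eulerProduct 0 = _ at h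
    rw [logDeriv_apply, eulerProduct_zero] at h
    simpa [logDeriv_apply] using h
  exact hderiv ▸ differentiableAt_eulerProduct_zero.hasDerivAt

lemma hasDerivAt_eulerProduct_cube_zero :
    HasDerivAt (fun q : ℂ ↦ eulerProduct (q ^ 3)) 0 0 := by
  have h := (hasDerivAt_pow 3 (0 : ℂ))
  have h2 : HasDerivAt eulerProduct (-1) ((0 : ℂ) ^ 3) := by
    simpa using hasDerivAt_eulerProduct_zero
  simpa [Function.comp_def] using h2.comp (0 : ℂ) h

/-- The Eisenstein series `E₆` as a function of the nome. -/
noncomputable def E6Nome : ℂ → ℂ := cuspFunction 1 ModularForm.E₆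

lemma E6Nome_qParam (z : ℍ) : E6Nome (Function.Periodic.qParam 1 z) = ModularForm.E₆ z :=
  SlashInvariantFormClass.eq_cuspFunction _ z one_mem_strictPeriods_SL one_ne_zero

lemma E6Nome_zero : E6Nome 0 = 1 := by
  have := EisensteinSeries.E_qExpansion_coeff_zero (k := 6) (by norm_num) ⟨3, rfl⟩
  simpa [qExpansion_coeff, E6Nome] using! this

lemma hasDerivAt_E6Nome_zero : HasDerivAt E6Nome (-504) 0 := by
  have hd : DifferentiableAt ℂ E6Nome 0 :=
    ModularFormClass.differentiableAt_cuspFunction ModularForm.E₆ one_pos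
      one_mem_strictPeriods_SL (by simp)
  have h : deriv E6Nome 0 = -504 := by
    simpa [qExpansion_coeff, E6Nome] using! ModularForm.E₆_qExpansion_coeff_one
  exact h ▸ hd.hasDerivAt

lemma hasDerivAt_E6Nome_cube_zero : HasDerivAt (fun q : ℂ ↦ E6Nome (q ^ 3)) 0 0 := by
  have h2 : HasDerivAt E6Nome (-504) ((0 : ℂ) ^ 3) := by
    simpa using hasDerivAt_E6Nome_zero
  simpa [Function.comp_def] using h2.comp (0 : ℂ) (hasDerivAt_pow 3 (0 : ℂ))

lemma tendsto_div_mul_of_hasDerivAt {N U : ℂ → ℂ} {c : ℂ} (hN : HasDerivAt N c 0) (hN0 : N 0 = 0)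
    (hU : ContinuousAt U 0) (hU0 : U 0 = 1) :
    Filter.Tendsto (fun q ↦ N q / (q * U q)) (𝓝[≠] 0) (𝓝 c) := by
  have h1 := hasDerivAt_iff_tendsto_slope_zero.mp hN
  have h2 := h1.div (hU.tendsto.mono_left nhdsWithin_le_nhds) (by simp [hU0])
  simp only [zero_add, hN0, sub_zero, hU0, div_one, smul_eq_mul] at h2
  refine h2.congr fun q ↦ ?_
  rw [Pi.div_apply, ← div_eq_inv_mul, div_div]

/-- `η(z)⁶η(3z)⁶` in terms of the nome, without its leading factor `q`. -/
noncomputable def etaUnit (q : ℂ) : ℂ := eulerProduct q ^ 6 * eulerProduct (q ^ 3) ^ 6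

lemma continuousAt_etaUnit_zero : ContinuousAt etaUnit 0 :=
  (differentiableAt_eulerProduct_zero.continuousAt.pow 6).mul
    (hasDerivAt_eulerProduct_cube_zero.continuousAt.pow 6)

lemma etaUnit_zero : etaUnit 0 = 1 := by simp [etaUnit, eulerProduct_zero]

/-- The expansion at `∞` of the weight-zero function `gammaThreeDefect`. -/
noncomputable def defectAtInfty (q : ℂ) : ℂ :=
  (E6Nome q - eulerProduct q ^ 18 / eulerProduct (q ^ 3) ^ 6 + 486 * (q * etaUnit q) +
    19683 * (q ^ 2 * (eulerProduct (q ^ 3) ^ 18 / eulerProduct q ^ 6))) / (q * etaUnit q)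

/-- The expansion at `0` of `gammaThreeDefect`, in the nome of `z / 3`. -/
noncomputable def defectAtZero (q : ℂ) : ℂ :=
  -27 * ((E6Nome (q ^ 3) - eulerProduct q ^ 18 / eulerProduct (q ^ 3) ^ 6 - 18 * (q * etaUnit q) +
    27 * (q ^ 2 * (eulerProduct (q ^ 3) ^ 18 / eulerProduct q ^ 6))) / (q * etaUnit q))

lemma hasDerivAt_etaQuotient_zero (e : ℂ → ℂ) {a b c : ℂ} (he : HasDerivAt e a 0) :
    HasDerivAt (fun q ↦ e q - eulerProduct q ^ 18 / eulerProduct (q ^ 3) ^ 6 +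
      b * (q * etaUnit q) + c * (q ^ 2 * (eulerProduct (q ^ 3) ^ 18 / eulerProduct q ^ 6)))
      (a + 18 + b) 0 := by
  have hP := hasDerivAt_eulerProduct_zero
  have hP3 := hasDerivAt_eulerProduct_cube_zero
  have hU := ((hP.fun_pow 6).mul (hP3.fun_pow 6))
  have h := ((he.sub ((hP.fun_pow 18).div (hP3.fun_pow 6) (by simp [eulerProduct_zero]))).add
    (((hasDerivAt_id (0 : ℂ)).mul hU).const_mul b)).add
    (((hasDerivAt_pow 2 (0 : ℂ)).mul
      ((hP3.fun_pow 18).div (hP.fun_pow 6) (by simp [eulerProduct_zero]))).const_mul c)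
  refine h.congr_deriv ?_
  simp [eulerProduct_zero]

lemma tendsto_defectAtInfty : Filter.Tendsto defectAtInfty (𝓝[≠] 0) (𝓝 0) := by
  have h := hasDerivAt_etaQuotient_zero E6Nome (b := 486) (c := 19683) hasDerivAt_E6Nome_zero
  norm_num at h
  exact tendsto_div_mul_of_hasDerivAt h (by simp [E6Nome_zero, eulerProduct_zero])
    continuousAt_etaUnit_zero etaUnit_zero

lemma tendsto_defectAtZero : ∃ c, Filter.Tendsto defectAtZero (𝓝[≠] 0) (𝓝 c) := by
  have h := hasDerivAt_etaQuotient_zero (fun q ↦ E6Nome (q ^ 3)) (b := -18) (c := 27)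
    hasDerivAt_E6Nome_cube_zero
  simp only [neg_mul, ← sub_eq_add_neg] at h
  exact ⟨_, (tendsto_div_mul_of_hasDerivAt h (by simp [E6Nome_zero, eulerProduct_zero])
    continuousAt_etaUnit_zero etaUnit_zero).const_mul _⟩

/-- The difference of the two sides of
`E₆(z) = η(z)¹⁸/η(3z)⁶ - 486 η(z)⁶η(3z)⁶ - 19683 η(3z)¹⁸/η(z)⁶`, divided by `η(z)⁶η(3z)⁶`. -/
noncomputable def gammaThreeDefect (z : ℍ) : ℂ :=
  (ModularForm.E₆ z - η z ^ 18 / η (3 * z) ^ 6 + 486 * (η z ^ 6 * η (3 * z) ^ 6) +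
    19683 * (η (3 * z) ^ 18 / η z ^ 6)) / (η z ^ 6 * η (3 * z) ^ 6)

lemma eta_eq_qParam_mul (z : ℂ) :
    η z = Function.Periodic.qParam 24 z * eulerProduct (Function.Periodic.qParam 1 z) := rfl

lemma qParam_one_eq_pow (z : ℂ) :
    Function.Periodic.qParam 1 z = Function.Periodic.qParam 24 z ^ 24 := by
  simp only [Function.Periodic.qParam, ← Complex.exp_nat_mul]
  congr 1
  push_cast
  ring

lemma qParam_self_add {h : ℝ} (hh : h ≠ 0) (z : ℂ) :
    Function.Periodic.qParam h (h + z) = Function.Periodic.qParam h z := by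
  have hh' : (h : ℂ) ≠ 0 := ofReal_ne_zero.mpr hh
  rw [Function.Periodic.qParam, mul_add, add_div, mul_div_cancel_right₀ _ hh', Complex.exp_add,
    exp_two_pi_mul_I, one_mul, Function.Periodic.qParam]

lemma qParam_three_mul (h : ℝ) (z : ℂ) :
    Function.Periodic.qParam h (3 * z) = Function.Periodic.qParam h z ^ 3 := by
  simp only [Function.Periodic.qParam, ← Complex.exp_nat_mul]
  congr 1
  push_cast
  ring

lemma three_mul_mem_upperHalfPlaneSet {z : ℂ} (hz : z ∈ upperHalfPlaneSet) :
    3 * z ∈ upperHalfPlaneSet := by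
  simpa [upperHalfPlaneSet] using hz

lemma div_three_mem_upperHalfPlaneSet {z : ℂ} (hz : z ∈ upperHalfPlaneSet) :
    z / 3 ∈ upperHalfPlaneSet := by
  simpa [upperHalfPlaneSet] using hz

lemma eulerProduct_qParam_ne_zero {z : ℂ} (hz : z ∈ upperHalfPlaneSet) :
    eulerProduct (Function.Periodic.qParam 1 z) ≠ 0 :=
  eulerProduct_ne_zero (Function.Periodic.norm_qParam_lt_one one_pos hz)

lemma gammaThreeDefect_eq (z : ℍ) :
    gammaThreeDefect z = defectAtInfty (Function.Periodic.qParam 1 z) := by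
  have hP := eulerProduct_qParam_ne_zero z.2
  have hP3 := eulerProduct_qParam_ne_zero (three_mul_mem_upperHalfPlaneSet z.2)
  have hx := Function.Periodic.qParam_ne_zero (h := 24) (z : ℂ)
  simp only [gammaThreeDefect, defectAtInfty, etaUnit, eta_eq_qParam_mul, E6Nome_qParam]
  simp only [qParam_three_mul, qParam_one_eq_pow (z : ℂ)] at hP hP3 ⊢
  field_simp

lemma sqrt_pow_six {z : ℂ} (hz : z ≠ 0) : sqrt z ^ 6 = z ^ 3 := by
  rw [sqrt_eq_exp hz, ← exp_nat_mul]
  ring_nf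
  rw [show log z * 3 = (3 : ℕ) * log z by push_cast; ring, exp_nat_mul, exp_log hz]

lemma exists_eta_neg_one_div_pow_six :
    ∃ k : ℂ, k ^ 2 = -1 ∧ ∀ z ∈ upperHalfPlaneSet, η (-1 / z) ^ 6 = k * z ^ 3 * η z ^ 6 := by
  refine ⟨((sqrt Complex.I)⁻¹) ^ 6, ?_, fun z hz ↦ ?_⟩
  · rw [inv_pow, sqrt_pow_six I_ne_zero, I_pow_three, inv_pow, neg_sq, I_sq]
    norm_num
  · have h := ModularForm.eta_comp_eq_csqrt_I_inv hz
    simp only [Function.comp_apply, Pi.smul_apply, Pi.mul_apply, smul_eq_mul] at h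
    rw [h, mul_pow, mul_pow, sqrt_pow_six (show z ≠ 0 from UpperHalfPlane.ne_zero ⟨z, hz⟩),
      mul_assoc]

lemma E₆_S_smul (z : ℍ) : ModularForm.E₆ (ModularGroup.S • z) = z ^ 6 * ModularForm.E₆ z := by
  have h := SlashInvariantForm.slash_action_eqn'' ModularForm.E₆
    (γ := (ModularGroup.S : GL (Fin 2) ℝ)) (MonoidHom.mem_range.mpr ⟨ModularGroup.S, rfl⟩) z
  rw [ModularGroup.denom_S] at h
  exact_mod_cast h

lemma gammaThreeDefect_S_smul (z : ℍ) : gammaThreeDefect (ModularGroup.S • z) =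
    defectAtZero (Function.Periodic.qParam 1 (z / 3)) := by
  obtain ⟨k, hk, h⟩ := exists_eta_neg_one_div_pow_six
  have hw := div_three_mem_upperHalfPlaneSet z.2
  obtain ⟨w, hw3⟩ : ∃ w : ℂ, (z : ℂ) = 3 * w := ⟨z / 3, by ring⟩
  have h0 := z.ne_zero
  have h1 := h z z.2
  have h2 := h _ hw
  have hE := E6Nome_qParam z
  have hS : ((ModularGroup.S • z : ℍ) : ℂ) = -1 / z := by
    rw [modular_S_smul, coe_mk, inv_neg, neg_div, one_div]
  have hS3 : 3 * (-1 / (z : ℂ)) = -1 / (z / 3) := by field_simp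
  have hP := eulerProduct_qParam_ne_zero hw
  have hP3 := eulerProduct_qParam_ne_zero z.2
  have hx := Function.Periodic.qParam_ne_zero (h := 24) w
  have hk0 : k ≠ 0 := by rintro rfl; norm_num at hk
  rw [gammaThreeDefect, E₆_S_smul, hS, hS3, show 18 = 6 * 3 from rfl, pow_mul, pow_mul, h1, h2,
    ← hE]
  rw [hw3, mul_div_cancel_left₀ _ (three_ne_zero)] at *
  simp only [defectAtZero, etaUnit, eta_eq_qParam_mul]
  simp only [qParam_three_mul, qParam_one_eq_pow w] at hP hP3 ⊢
  have hw0 : w ≠ 0 := by rintro rfl; simp at h0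
  generalize eulerProduct (Function.Periodic.qParam 24 w ^ 24) = P at *
  generalize eulerProduct ((Function.Periodic.qParam 24 w ^ 24) ^ 3) = Q at *
  generalize E6Nome ((Function.Periodic.qParam 24 w ^ 24) ^ 3) = E at *
  generalize Function.Periodic.qParam 24 w = x at *
  field_simp
  linear_combination 3 ^ 9 * E * P ^ 6 * Q ^ 6 * hk

lemma tendsto_qParam_atImInfty {h : ℝ} (hh : 0 < h) :
    Filter.Tendsto (fun z : ℍ ↦ Function.Periodic.qParam h z) atImInfty (𝓝[≠] 0) :=
  (Function.Periodic.qParam_tendsto hh).comp tendsto_coe_atImInfty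

lemma isZeroAtImInfty_gammaThreeDefect : IsZeroAtImInfty gammaThreeDefect :=
  (tendsto_defectAtInfty.comp (tendsto_qParam_atImInfty one_pos)).congr
    fun z ↦ (gammaThreeDefect_eq z).symm

lemma qParam_one_div_three (z : ℂ) :
    Function.Periodic.qParam 1 (z / 3) = Function.Periodic.qParam 3 z := by
  simp [Function.Periodic.qParam, mul_div_assoc]

lemma isBoundedAtImInfty_gammaThreeDefect_S_smul :
    IsBoundedAtImInfty fun z ↦ gammaThreeDefect (ModularGroup.S • z) := by
  obtain ⟨c, hc⟩ := tendsto_defectAtZero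
  refine Filter.Tendsto.isBigO_one (c := c) ℝ
    ((hc.comp (tendsto_qParam_atImInfty three_pos)).congr fun z ↦ ?_)
  rw [gammaThreeDefect_S_smul, qParam_one_div_three, Function.comp_apply]

lemma gammaThreeDefect_T_smul (z : ℍ) :
    gammaThreeDefect (ModularGroup.T • z) = gammaThreeDefect z := by
  rw [gammaThreeDefect_eq, gammaThreeDefect_eq, modular_T_smul, coe_vadd, qParam_self_add one_ne_zero]

lemma gammaThreeDefect_S_T_cube_smul (z : ℍ) :
    gammaThreeDefect (ModularGroup.S • ModularGroup.T • ModularGroup.T • ModularGroup.T • z) =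
      gammaThreeDefect (ModularGroup.S • z) := by
  simp only [gammaThreeDefect_S_smul, modular_T_smul, qParam_one_div_three]
  rw [← qParam_self_add three_ne_zero (z : ℂ), coe_vadd, coe_vadd, coe_vadd]
  congr 2
  push_cast
  ring

lemma mdifferentiable_gammaThreeDefect : MDiff gammaThreeDefect := by
  rw [UpperHalfPlane.mdifferentiable_iff]
  have hη : DifferentiableOn ℂ η upperHalfPlaneSet := fun z hz ↦
    (ModularForm.differentiableAt_eta_of_mem_upperHalfPlaneSet hz).differentiableWithinAt
  have hη3 : DifferentiableOn ℂ (fun z ↦ η (3 * z)) upperHalfPlaneSet :=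
    hη.comp (by fun_prop) fun z hz ↦ three_mul_mem_upperHalfPlaneSet hz
  have h0 (z : ℂ) (hz : z ∈ upperHalfPlaneSet) := ModularForm.eta_ne_zero hz
  have h03 (z : ℂ) (hz : z ∈ upperHalfPlaneSet) :=
    h0 _ (three_mul_mem_upperHalfPlaneSet hz)
  have hE := UpperHalfPlane.mdifferentiable_iff.mp (ModularForm.E₆).holo'
  refine ((((hE.sub ((hη.pow 18).div (hη3.pow 6) fun z hz ↦ pow_ne_zero _ (h03 z hz))).add
    (((hη.pow 6).mul (hη3.pow 6)).const_mul 486)).add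
    (((hη3.pow 18).div (hη.pow 6) fun z hz ↦ pow_ne_zero _ (h0 z hz)).const_mul 19683)).div
    ((hη.pow 6).mul (hη3.pow 6)) fun z hz ↦
      mul_ne_zero (pow_ne_zero _ (h0 z hz)) (pow_ne_zero _ (h03 z hz))).congr fun z hz ↦ ?_
  simp [gammaThreeDefect, ofComplex_apply_of_im_pos hz]

lemma E₆_eq_eta (z : ℍ) : ModularForm.E₆ z = η z ^ 18 / η (3 * z) ^ 6 -
    486 * (η z ^ 6 * η (3 * z) ^ 6) - 19683 * (η (3 * z) ^ 18 / η z ^ 6) := by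
  have h := congrFun (eq_zero_of_gamma0_three_invariant mdifferentiable_gammaThreeDefect
    gammaThreeDefect_T_smul gammaThreeDefect_S_T_cube_smul isZeroAtImInfty_gammaThreeDefect
    isBoundedAtImInfty_gammaThreeDefect_S_smul) z
  have h0 := ModularForm.eta_ne_zero z.2
  have h03 := ModularForm.eta_ne_zero (three_mul_mem_upperHalfPlaneSet z.2)
  rw [gammaThreeDefect, Pi.zero_apply, div_eq_zero_iff] at h
  have h' := h.resolve_right (mul_ne_zero (pow_ne_zero _ h0) (pow_ne_zero _ h03))
  linear_combination h'

lemma dedekindEta_eq_eta (z : ℂ) : dedekindEta z = η z := by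
  simp only [dedekindEta, ModularForm.eta, ModularForm.eta_q_eq_cexp, qq,
    Function.Periodic.qParam, mul_assoc]
  congr 2
  push_cast
  ring

lemma E4_eq_E₄ (z : ℍ) : E4 z = ModularForm.E₄ z := by
  have h := EisensteinSeries.q_expansion_bernoulli (by norm_num : 3 ≤ 4) ⟨2, rfl⟩ z
  rw [show bernoulli 4 = -1 / 30 by decide +kernel] at h
  rw [ModularForm.E₄, h, tsum_pnat_eq_tsum_succ
    (f := fun n : ℕ ↦ (ArithmeticFunction.sigma 3 n : ℂ) *
      cexp (2 * Real.pi * Complex.I * z) ^ (n : ℤ))]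
  simp only [E4, sigma', qq, ArithmeticFunction.sigma_apply, zpow_natCast]
  norm_num

/-- `j = ψ³ + 756 + 196830 φ³ + 19131876 (φ³)² + 387420489 (φ³)³`. -/
theorem j_eq_level3 : ∀ z : ℍ, jfun z = psi3 z + 756 + 196830 * phi3 z
    + 19131876 * phi3 z ^ 2 + 387420489 * phi3 z ^ 3 := by
  intro z
  have h0 := ModularForm.eta_ne_zero z.2
  have h03 := ModularForm.eta_ne_zero (three_mul_mem_upperHalfPlaneSet z.2)
  have hΔ := ModularForm.discriminant_eq_E₄_cube_sub_E₆_sq z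
  have h4 : ModularForm.E₄ z ^ 3 = ModularForm.E₆ z ^ 2 + 1728 * η z ^ 24 := by
    rw [ModularForm.discriminant] at hΔ
    linear_combination -1728 * hΔ
  simp only [jfun, Δfun, phi3, psi3, E4_eq_E₄, dedekindEta_eq_eta, h4, E₆_eq_eta]
  field_simp
  ring
end
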